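/- arXiv:2604.19020 — 2 statements merged into one kernel-verified Lean document; each statement's English description precedes it below -/
import Mathlib

section
/- Assume f satisfies condition (OSC). There exist constants Λ₈, Λ₉ > 0, depending only on n, Ω, Ω̃ and f, such that every strictly convex solution u ∈ C²(Ω̄) of the second boundary value problem with data (f, c) satisfies, for all x ∈ Ω: Λ₈ ≤ trace(D²u(x)·S(∇u(x))·D²u(x)) ≤ Λ₉ and Λ₈ ≤ trace(S(∇u(x))) ≤ Λ₉. (With ũ the Legendre transform of u and y = ∇u(x), these two quantities are Σᵢ ∂G̃/∂μᵢ and Σᵢ (∂G̃/∂μᵢ)μᵢ², where μᵢ are the eigenvalues of D²ũ(y) = (D²u(x))⁻¹ and G̃(y, D²ũ) = −Σᵢⱼ S(y)ᵢⱼ((D²ũ)⁻¹)ᵢⱼ is the Legendre-dual operator.) -/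
open Set MeasureTheory Matrix
open scoped Topology RealInnerProductSpace NNReal

noncomputable section

abbrev Euc (n : ℕ) := EuclideanSpace ℝ (Fin n)

variable {n : ℕ}

/-- Hessian matrix of `u` at `x`. -/
def Hess (u : Euc n → ℝ) (x : Euc n) : Matrix (Fin n) (Fin n) ℝ :=
  fun i j => iteratedFDeriv ℝ 2 u x ![EuclideanSpace.single i 1, EuclideanSpace.single j 1]

/-- `A ≤ B` in the sense of symmetric matrices. -/
def MatLE (A B : Matrix (Fin n) (Fin n) ℝ) : Prop := (B - A).PosSemidef

/-- The Minkowski mean-curvature operator `div (∇u / √(1 - |∇u|²))`. -/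
def MinkDiv (u : Euc n → ℝ) (x : Euc n) : ℝ :=
  ∑ i, fderiv ℝ (fun y => (Real.sqrt (1 - ‖gradient u y‖ ^ 2))⁻¹ * gradient u y i) x
    (EuclideanSpace.single i 1)

/-- The Euclidean mean-curvature operator `div (∇u / √(1 + |∇u|²))`. -/
def EucDiv (u : Euc n → ℝ) (x : Euc n) : ℝ :=
  ∑ i, fderiv ℝ (fun y => (Real.sqrt (1 + ‖gradient u y‖ ^ 2))⁻¹ * gradient u y i) x
    (EuclideanSpace.single i 1)

/-- `S(p) = (1/v)(Iₙ + p pᵀ / v²)`, `v = √(1-|p|²)`. -/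
def Smat (p : Euc n) : Matrix (Fin n) (Fin n) ℝ :=
  (Real.sqrt (1 - ‖p‖ ^ 2))⁻¹ •
    ((1 : Matrix (Fin n) (Fin n) ℝ) +
      (1 - ‖p‖ ^ 2)⁻¹ • Matrix.vecMulVec (fun i => p i) (fun j => p j))

/-- `B(p) = Iₙ + p pᵀ / (v (1 + v))`, `v = √(1-|p|²)`. -/
def Bmat (p : Euc n) : Matrix (Fin n) (Fin n) ℝ :=
  (1 : Matrix (Fin n) (Fin n) ℝ) +
    (Real.sqrt (1 - ‖p‖ ^ 2) * (1 + Real.sqrt (1 - ‖p‖ ^ 2)))⁻¹ •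
      Matrix.vecMulVec (fun i => p i) (fun j => p j)

/-- `A(x) = (1/v)·B(∇u)·D²u·B(∇u)`: its eigenvalues are the principal curvatures. -/
def Amat (u : Euc n → ℝ) (x : Euc n) : Matrix (Fin n) (Fin n) ℝ :=
  (Real.sqrt (1 - ‖gradient u x‖ ^ 2))⁻¹ •
    (Bmat (gradient u x) * Hess u x * Bmat (gradient u x))

/-- supremum of the quadratic form of `A` over the unit sphere (the operator
norm / largest eigenvalue for a positive semidefinite symmetric `A`). -/
def quadSup (A : Matrix (Fin n) (Fin n) ℝ) : ℝ :=
  ⨆ ξ : Metric.sphere (0 : Euc n) 1,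
    (fun i => (ξ : Euc n) i) ⬝ᵥ A.mulVec (fun i => (ξ : Euc n) i)

/-- The domains `Ω = {h̃ > 0}`, `Ω̃ = {h > 0}` are bounded uniformly convex domains
with smooth boundary, described by the defining functions `h̃` and `h`. -/
def DomainSetup (Ω Ωt : Set (Euc n)) (ht h : Euc n → ℝ) (θt θ : ℝ) : Prop :=
  IsOpen Ω ∧ IsOpen Ωt ∧ Bornology.IsBounded Ω ∧ Bornology.IsBounded Ωt ∧
  Ω.Nonempty ∧ Ωt.Nonempty ∧
  ContDiff ℝ (⊤ : ℕ∞) ht ∧ ContDiff ℝ (⊤ : ℕ∞) h ∧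
  Ω = {x | 0 < ht x} ∧ Ωt = {y | 0 < h y} ∧
  (∀ x ∈ frontier Ω, ‖gradient ht x‖ = 1) ∧
  (∀ y ∈ frontier Ωt, ‖gradient h y‖ = 1) ∧
  0 < θt ∧ 0 < θ ∧
  (∀ x : Euc n, MatLE (Hess ht x) ((-θt) • (1 : Matrix (Fin n) (Fin n) ℝ))) ∧
  (∀ y : Euc n, MatLE (Hess h y) ((-θ) • (1 : Matrix (Fin n) (Fin n) ℝ)))

/-- `f ∈ 𝒜`: `f` is `C²` on `Ω̄ × closure Ω̃` and concave in `x`. -/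
def InA (Ω Ωt : Set (Euc n)) (f : Euc n × Euc n → ℝ) : Prop :=
  ContDiffOn ℝ 2 f (closure Ω ×ˢ closure Ωt) ∧
  ∀ p ∈ closure Ωt, ConcaveOn ℝ (closure Ω) (fun x => f (x, p))

/-- Condition (OSC): `osc f ≤ (n/2)(|Ω̃|/|Ω|)^{1/n}`. -/
def OSCcond (Ω Ωt : Set (Euc n)) (f : Euc n × Euc n → ℝ) : Prop :=
  ∀ x ∈ closure Ω, ∀ y ∈ closure Ω, ∀ p ∈ closure Ωt, ∀ q ∈ closure Ωt,
    |f (x, p) - f (y, q)| ≤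
      ((n : ℝ) / 2) * ((volume Ωt).toReal / (volume Ω).toReal) ^ ((1 : ℝ) / n)

/-- `‖f‖_{C²(Ω̄ × closure Ω̃)} ≤ K`. -/
def C2Bound (Ω Ωt : Set (Euc n)) (f : Euc n × Euc n → ℝ) (K : ℝ) : Prop :=
  ContDiffOn ℝ 2 f (closure Ω ×ˢ closure Ωt) ∧
  ∀ z ∈ closure Ω ×ˢ closure Ωt,
    |f z| ≤ K ∧ ‖fderiv ℝ f z‖ ≤ K ∧ ‖iteratedFDeriv ℝ 2 f z‖ ≤ K

/-- `sup |D_x f| ≤ ε` on `Ω̄ × closure Ω̃`. -/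
def DxBound (Ω Ωt : Set (Euc n)) (f : Euc n × Euc n → ℝ) (ε : ℝ) : Prop :=
  ∀ x ∈ closure Ω, ∀ p ∈ closure Ωt, ‖fderiv ℝ (fun x' => f (x', p)) x‖ ≤ ε

/-- `sup |D_{xp} f| ≤ ε` on `Ω̄ × closure Ω̃`. -/
def DxpBound (Ω Ωt : Set (Euc n)) (f : Euc n × Euc n → ℝ) (ε : ℝ) : Prop :=
  ∀ x ∈ closure Ω, ∀ p ∈ closure Ωt,
    ‖fderiv ℝ (fun p' => fderiv ℝ (fun x' => f (x', p')) x) p‖ ≤ ε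

/-- A strictly convex solution of the second boundary value problem. -/
def IsStrictSol (Ω Ωt : Set (Euc n)) (f : Euc n × Euc n → ℝ) (c : ℝ) (u : Euc n → ℝ) : Prop :=
  ContDiffOn ℝ 2 u (closure Ω) ∧
  (∀ x ∈ closure Ω, (Hess u x).PosDef) ∧
  (∀ x ∈ closure Ω, ‖gradient u x‖ < 1) ∧
  (∀ x ∈ Ω, MinkDiv u x = f (x, gradient u x) + c) ∧
  gradient u '' Ω = Ωt

/-- A smooth uniformly convex solution of the second boundary value problem. -/
def IsSmoothSol (Ω Ωt : Set (Euc n)) (f : Euc n × Euc n → ℝ) (c : ℝ) (u : Euc n → ℝ) : Prop :=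
  ContDiffOn ℝ (⊤ : ℕ∞) u (closure Ω) ∧
  (∃ δ : ℝ, 0 < δ ∧ ∀ x ∈ closure Ω, MatLE (δ • (1 : Matrix (Fin n) (Fin n) ℝ)) (Hess u x)) ∧
  (∀ x ∈ closure Ω, ‖gradient u x‖ < 1) ∧
  (∀ x ∈ Ω, MinkDiv u x = f (x, gradient u x) + c) ∧
  gradient u '' Ω = Ωt

/-- A uniformly convex `C^{2}` solution of the second boundary value problem. -/
def IsUCSol (Ω Ωt : Set (Euc n)) (f : Euc n × Euc n → ℝ) (c : ℝ) (u : Euc n → ℝ) : Prop :=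
  ContDiffOn ℝ 2 u (closure Ω) ∧
  (∃ δ : ℝ, 0 < δ ∧ ∀ x ∈ closure Ω, MatLE (δ • (1 : Matrix (Fin n) (Fin n) ℝ)) (Hess u x)) ∧
  (∀ x ∈ closure Ω, ‖gradient u x‖ < 1) ∧
  (∀ x ∈ Ω, MinkDiv u x = f (x, gradient u x) + c) ∧
  gradient u '' Ω = Ωt

/-- A uniformly convex `C^{4,α}` solution of the second boundary value problem
for the Minkowski mean-curvature operator. -/
def IsC4Sol (Ω Ωt : Set (Euc n)) (f : Euc n × Euc n → ℝ) (c : ℝ) (u : Euc n → ℝ)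
    (α : ℝ) : Prop :=
  ContDiffOn ℝ 4 u (closure Ω) ∧
  (∃ C : ℝ≥0, HolderOnWith C (Real.toNNReal α) (fun x => iteratedFDeriv ℝ 4 u x) (closure Ω)) ∧
  (∃ δ : ℝ, 0 < δ ∧ ∀ x ∈ closure Ω, MatLE (δ • (1 : Matrix (Fin n) (Fin n) ℝ)) (Hess u x)) ∧
  (∀ x ∈ closure Ω, ‖gradient u x‖ < 1) ∧
  (∀ x ∈ Ω, MinkDiv u x = f (x, gradient u x) + c) ∧
  gradient u '' Ω = Ωt

/-- A uniformly convex `C^{4,α}` solution of the second boundary value problem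
for the Euclidean mean-curvature operator. -/
def IsC4SolE (Ω Ωt : Set (Euc n)) (f : Euc n × Euc n → ℝ) (c : ℝ) (u : Euc n → ℝ)
    (α : ℝ) : Prop :=
  ContDiffOn ℝ 4 u (closure Ω) ∧
  (∃ C : ℝ≥0, HolderOnWith C (Real.toNNReal α) (fun x => iteratedFDeriv ℝ 4 u x) (closure Ω)) ∧
  (∃ δ : ℝ, 0 < δ ∧ ∀ x ∈ closure Ω, MatLE (δ • (1 : Matrix (Fin n) (Fin n) ℝ)) (Hess u x)) ∧
  (∀ x ∈ Ω, EucDiv u x = f (x, gradient u x) + c) ∧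
  gradient u '' Ω = Ωt

/-- `ũ` is the Legendre transform of `u`. -/
def IsLegendre (Ω Ωt : Set (Euc n)) (u ut : Euc n → ℝ) : Prop :=
  ContDiffOn ℝ (⊤ : ℕ∞) ut (closure Ωt) ∧
  (∀ x ∈ closure Ω, ut (gradient u x) = ⟪x, gradient u x⟫ - u x) ∧
  (∀ x ∈ closure Ω, gradient ut (gradient u x) = x) ∧
  (∀ x ∈ closure Ω, Hess ut (gradient u x) = (Hess u x)⁻¹)

/-- Entries of a positive semidefinite real matrix satisfy `Aᵢⱼ² ≤ Aᵢᵢ Aⱼⱼ`. -/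
theorem sq_apply_le_of_posSemidef {A : Matrix (Fin n) (Fin n) ℝ} (hA : A.PosSemidef)
    (i j : Fin n) : A i j ^ 2 ≤ A i i * A j j := by
  have hdet := (hA.submatrix ![i, j]).det_nonneg
  have hsymm : A j i = A i j := by simpa using hA.isHermitian.apply i j
  rw [Matrix.det_fin_two] at hdet
  simp only [Matrix.submatrix_apply, Matrix.cons_val_zero, Matrix.cons_val_one, hsymm] at hdet
  nlinarith

theorem sum_sq_le_sq_trace {A : Matrix (Fin n) (Fin n) ℝ} (hA : A.PosSemidef) :
    ∑ i, ∑ j, A i j ^ 2 ≤ A.trace ^ 2 := by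
  rw [sq, Matrix.trace, Finset.sum_mul_sum]
  exact Finset.sum_le_sum fun i _ => Finset.sum_le_sum fun j _ => sq_apply_le_of_posSemidef hA i j

theorem sq_trace_le_card_mul_sum_sq (A : Matrix (Fin n) (Fin n) ℝ) :
    A.trace ^ 2 ≤ n * ∑ i, ∑ j, A i j ^ 2 := by
  have h1 : A.trace ^ 2 ≤ n * ∑ i, A i i ^ 2 := by
    simpa [Matrix.trace] using
      sq_sum_le_card_mul_sum_sq (s := (Finset.univ : Finset (Fin n))) (f := fun i => A i i)
  refine h1.trans (mul_le_mul_of_nonneg_left (Finset.sum_le_sum fun i _ => ?_) n.cast_nonneg)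
  exact Finset.single_le_sum (f := fun j => A i j ^ 2) (fun j _ => sq_nonneg _)
    (Finset.mem_univ i)

theorem sum_sq_mulVec_le (A : Matrix (Fin n) (Fin n) ℝ) (p : Euc n) :
    ∑ i, (∑ j, A i j * p j) ^ 2 ≤ ‖p‖ ^ 2 * ∑ i, ∑ j, A i j ^ 2 := by
  rw [EuclideanSpace.real_norm_sq_eq, Finset.mul_sum]
  refine Finset.sum_le_sum fun i _ => ?_
  rw [mul_comm]
  exact Finset.sum_mul_sq_le_sq_mul_sq _ _ _

theorem quadForm_le_trace {A : Matrix (Fin n) (Fin n) ℝ} (hA : A.PosSemidef) (p : Euc n) :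
    ∑ i, p i * ∑ j, A i j * p j ≤ ‖p‖ ^ 2 * A.trace := by
  have htr : 0 ≤ A.trace := hA.trace_nonneg
  refine abs_le_of_sq_le_sq' ?_ (by positivity) |>.2
  calc (∑ i, p i * ∑ j, A i j * p j) ^ 2
      ≤ (∑ i, p i ^ 2) * ∑ i, (∑ j, A i j * p j) ^ 2 := Finset.sum_mul_sq_le_sq_mul_sq _ _ _
    _ = ‖p‖ ^ 2 * ∑ i, (∑ j, A i j * p j) ^ 2 := by rw [EuclideanSpace.real_norm_sq_eq]
    _ ≤ ‖p‖ ^ 2 * (‖p‖ ^ 2 * A.trace ^ 2) := by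
        refine mul_le_mul_of_nonneg_left ((sum_sq_mulVec_le A p).trans ?_) (by positivity)
        exact mul_le_mul_of_nonneg_left (sum_sq_le_sq_trace hA) (by positivity)
    _ = (‖p‖ ^ 2 * A.trace) ^ 2 := by ring

theorem quadForm_nonneg {A : Matrix (Fin n) (Fin n) ℝ} (hA : A.PosSemidef) (p : Euc n) :
    0 ≤ ∑ i, p i * ∑ j, A i j * p j := by
  simpa [dotProduct, Matrix.mulVec] using hA.dotProduct_mulVec_nonneg (fun i => p i)

/-- The arithmetic-geometric mean inequality for the eigenvalues. -/
theorem det_le_trace_div_pow (hn : 0 < n) {A : Matrix (Fin n) (Fin n) ℝ} (hA : A.PosSemidef) :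
    A.det ≤ (A.trace / n) ^ n := by
  have hn' : (0 : ℝ) < n := by exact_mod_cast hn
  have hev := hA.eigenvalues_nonneg
  have hdet : A.det = ∏ i, hA.isHermitian.eigenvalues i := by
    simpa using hA.isHermitian.det_eq_prod_eigenvalues
  have htr : A.trace = ∑ i, hA.isHermitian.eigenvalues i := by
    simpa using hA.isHermitian.trace_eq_sum_eigenvalues
  have h := Real.geom_mean_le_arith_mean (Finset.univ : Finset (Fin n)) (fun _ => 1)
    hA.isHermitian.eigenvalues (fun _ _ => zero_le_one) (by simpa using hn) (fun i _ => hev i)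
  simp only [Real.rpow_one, one_mul, Finset.sum_const, Finset.card_univ, Fintype.card_fin,
    nsmul_eq_mul, mul_one, ← hdet, ← htr] at h
  calc A.det = (A.det ^ ((n : ℝ)⁻¹)) ^ n :=
        (Real.rpow_inv_natCast_pow hA.det_nonneg hn.ne').symm
    _ ≤ (A.trace / n) ^ n := pow_le_pow_left₀ (Real.rpow_nonneg hA.det_nonneg _) h n

theorem trace_Smat (p : Euc n) :
    (Smat p).trace = (Real.sqrt (1 - ‖p‖ ^ 2))⁻¹ * (n + (1 - ‖p‖ ^ 2)⁻¹ * ‖p‖ ^ 2) := by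
  have hp : (fun i => p i) ⬝ᵥ (fun i => p i) = ‖p‖ ^ 2 := by
    rw [EuclideanSpace.real_norm_sq_eq]
    simp only [dotProduct, sq]
  simp only [Smat, Matrix.trace_smul, Matrix.trace_add, Matrix.trace_one, Matrix.trace_vecMulVec,
    hp, Fintype.card_fin, smul_eq_mul]

theorem trace_mul_Smat_mul {A : Matrix (Fin n) (Fin n) ℝ} (hA : A.IsHermitian) (p : Euc n) :
    (A * Smat p * A).trace = (Real.sqrt (1 - ‖p‖ ^ 2))⁻¹ *
      (∑ i, ∑ j, A i j ^ 2 + (1 - ‖p‖ ^ 2)⁻¹ * ∑ i, (∑ j, A i j * p j) ^ 2) := by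
  have hsymm : ∀ i j, A j i = A i j := fun i j => by simpa using hA.apply i j
  have hvec : Matrix.vecMul (fun i => p i) A = A.mulVec (fun i => p i) := by
    ext i
    simp only [Matrix.vecMul, Matrix.mulVec, dotProduct]
    exact Finset.sum_congr rfl fun j _ => by rw [hsymm, mul_comm]
  have hsq : (A * A).trace = ∑ i, ∑ j, A i j ^ 2 := by
    simp only [Matrix.trace, Matrix.diag_apply, Matrix.mul_apply]
    exact Finset.sum_congr rfl fun i _ => Finset.sum_congr rfl fun j _ => by rw [hsymm i j, sq]
  simp only [Smat, Matrix.mul_smul, Matrix.smul_mul, Matrix.mul_add, Matrix.add_mul,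
    Matrix.mul_one, Matrix.trace_smul, Matrix.trace_add, Matrix.mul_vecMulVec,
    Matrix.vecMulVec_mul, Matrix.trace_vecMulVec, hvec, hsq, smul_eq_mul]
  simp [dotProduct, Matrix.mulVec, sq]

/-- Two-sided bounds for the coefficients of `Smat` away from the unit sphere. -/
theorem Smat_coeff_bounds {p : Euc n} {w : ℝ} (hw : 0 < w) (hp : w ≤ 1 - ‖p‖ ^ 2) :
    1 ≤ (Real.sqrt (1 - ‖p‖ ^ 2))⁻¹ ∧ (Real.sqrt (1 - ‖p‖ ^ 2))⁻¹ ≤ w⁻¹ ∧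
      0 ≤ (1 - ‖p‖ ^ 2)⁻¹ ∧ (1 - ‖p‖ ^ 2)⁻¹ ≤ w⁻¹ := by
  have h1 : 0 < 1 - ‖p‖ ^ 2 := hw.trans_le hp
  have h2 : 1 - ‖p‖ ^ 2 ≤ 1 := by nlinarith [sq_nonneg ‖p‖]
  have h3 : Real.sqrt (1 - ‖p‖ ^ 2) ≤ 1 := Real.sqrt_le_one.2 h2
  have h4 : w ≤ Real.sqrt (1 - ‖p‖ ^ 2) := by
    refine hp.trans (Real.le_sqrt_of_sq_le ?_)
    nlinarith
  exact ⟨(one_le_inv₀ (Real.sqrt_pos.2 h1)).2 h3, inv_anti₀ hw h4, inv_nonneg.2 h1.le,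
    inv_anti₀ hw hp⟩

/-- A differentiable function with a local maximum has nonpositive second derivative there. -/
theorem second_deriv_nonpos_of_isLocalMax {φ φ' : ℝ → ℝ} {a d : ℝ} (hmax : IsLocalMax φ a)
    (hφ : ∀ᶠ t in 𝓝 a, HasDerivAt φ (φ' t) t) (hφ' : HasDerivAt φ' d a) : d ≤ 0 := by
  by_contra! hd
  have hderiv : deriv φ =ᶠ[𝓝 a] φ' := hφ.mono fun t h => h.deriv
  have hdd : deriv (deriv φ) a = d := by rw [hderiv.deriv_eq, hφ'.deriv]
  have hmin : IsLocalMin φ a := isLocalMin_of_deriv_deriv_pos (by rw [hdd]; exact hd)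
    hmax.deriv_eq_zero hφ.self_of_nhds.continuousAt
  have hconst : φ =ᶠ[𝓝 a] fun _ => φ a := by
    filter_upwards [hmax, hmin] with t h1 h2 using le_antisymm h1 h2
  have hzero : deriv (deriv φ) a = 0 := by
    rw [hconst.deriv.deriv_eq]
    simp
  linarith

variable {u : Euc n → ℝ} {x : Euc n}

theorem gradient_apply (u : Euc n → ℝ) (x : Euc n) (i : Fin n) :
    gradient u x i = fderiv ℝ u x (EuclideanSpace.single i 1) := by
  rw [← toDual_gradient, InnerProductSpace.toDual_apply_apply,
    EuclideanSpace.inner_single_right]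
  simp

theorem Hess_apply (u : Euc n → ℝ) (x : Euc n) (i j : Fin n) :
    Hess u x i j =
      fderiv ℝ (fderiv ℝ u) x (EuclideanSpace.single i 1) (EuclideanSpace.single j 1) := by
  simp [Hess, iteratedFDeriv_two_apply]

/-- The derivative of the gradient map. -/
def gradientDeriv (u : Euc n → ℝ) (x : Euc n) : Euc n →L[ℝ] Euc n :=
  (EuclideanSpace.equiv (Fin n) ℝ).symm.toContinuousLinearMap ∘L
    ContinuousLinearMap.pi fun i =>
      ContinuousLinearMap.apply ℝ ℝ (EuclideanSpace.single i 1) ∘L fderiv ℝ (fderiv ℝ u) x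

theorem hasFDerivAt_gradient (hu : ContDiffAt ℝ 2 u x) :
    HasFDerivAt (gradient u) (gradientDeriv u x) x := by
  have h : DifferentiableAt ℝ (fderiv ℝ u) x :=
    (hu.fderiv_right (m := 1) (by norm_num)).differentiableAt (by norm_num)
  refine hasFDerivWithinAt_univ.1 (hasFDerivWithinAt_euclidean.2 fun i => ?_)
  rw [hasFDerivWithinAt_univ]
  simp only [gradient_apply]
  exact (ContinuousLinearMap.apply ℝ ℝ (EuclideanSpace.single i (1 : ℝ))).hasFDerivAt.comp x
    h.hasFDerivAt

theorem gradientDeriv_single_apply (u : Euc n → ℝ) (x : Euc n) (i j : Fin n) :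
    gradientDeriv u x (EuclideanSpace.single i 1) j = Hess u x i j := by
  rw [Hess_apply]
  simp [gradientDeriv]

theorem det_gradientDeriv (u : Euc n → ℝ) (x : Euc n) :
    (gradientDeriv u x).det = (Hess u x).det := by
  rw [ContinuousLinearMap.det, ← LinearMap.det_toMatrix (EuclideanSpace.basisFun (Fin n) ℝ).toBasis,
    ← Matrix.det_transpose (Hess u x)]
  congr 1
  ext i j
  simp [LinearMap.toMatrix_apply, gradientDeriv_single_apply]

theorem hasFDerivAt_gradient_apply (hu : ContDiffAt ℝ 2 u x) (i : Fin n) :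
    HasFDerivAt (fun y => gradient u y i)
      (EuclideanSpace.proj i ∘L gradientDeriv u x) x :=
  (EuclideanSpace.proj (𝕜 := ℝ) i).hasFDerivAt.comp x (hasFDerivAt_gradient hu)

theorem MinkDiv_eq (hu : ContDiffAt ℝ 2 u x) (hlt : ‖gradient u x‖ < 1) :
    MinkDiv u x = (Real.sqrt (1 - ‖gradient u x‖ ^ 2))⁻¹ * ((Hess u x).trace +
      (1 - ‖gradient u x‖ ^ 2)⁻¹ *
        ∑ i, gradient u x i * ∑ j, Hess u x i j * gradient u x j) := by
  have hpos : 0 < 1 - ‖gradient u x‖ ^ 2 := by nlinarith [norm_nonneg (gradient u x)]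
  have hv : 0 < Real.sqrt (1 - ‖gradient u x‖ ^ 2) := Real.sqrt_pos.2 hpos
  have hvsq := Real.sq_sqrt hpos.le
  have hterm : ∀ i, fderiv ℝ (fun y => (Real.sqrt (1 - ‖gradient u y‖ ^ 2))⁻¹ * gradient u y i) x
      (EuclideanSpace.single i 1) = (Real.sqrt (1 - ‖gradient u x‖ ^ 2))⁻¹ * (Hess u x i i +
      (1 - ‖gradient u x‖ ^ 2)⁻¹ * (gradient u x i * ∑ j, Hess u x i j * gradient u x j)) := by
    intro i
    have hg := hasFDerivAt_gradient hu
    have hF := ((hasDerivAt_inv hv.ne').comp_hasFDerivAt x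
      ((hg.norm_sq.const_sub 1).sqrt hpos.ne')).mul (hasFDerivAt_gradient_apply hu i)
    refine (congrArg (fun L => L (EuclideanSpace.single i 1)) hF.fderiv).trans ?_
    have hinner : inner ℝ (gradient u x) (gradientDeriv u x (EuclideanSpace.single i 1)) =
        ∑ j, Hess u x i j * gradient u x j := by
      simp only [PiLp.inner_apply, gradientDeriv_single_apply, RCLike.inner_apply, conj_trivial]
    simp only [_root_.add_apply, _root_.smul_apply,
      _root_.neg_apply, ContinuousLinearMap.comp_apply, innerSL_apply_apply,
      PiLp.proj_apply, gradientDeriv_single_apply, hinner, smul_eq_mul, nsmul_eq_mul,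
      Function.comp_apply, hvsq]
    field_simp
    push_cast
    ring
  rw [MinkDiv, Finset.sum_congr rfl fun i _ => hterm i, ← Finset.mul_sum,
    Finset.sum_add_distrib, ← Finset.mul_sum]
  rfl

/-- A function with gradient at most one on a ball of radius `ρ` cannot have Laplacian
exceeding `2n/ρ` everywhere in the ball. -/
theorem exists_trace_Hess_le {x₀ : Euc n} {ρ : ℝ} (hρ : 0 < ρ)
    (hu : ∀ y ∈ Metric.closedBall x₀ ρ, ContDiffAt ℝ 2 u y)
    (hgrad : ∀ y ∈ Metric.closedBall x₀ ρ, ‖gradient u y‖ ≤ 1) :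
    ∃ y ∈ Metric.closedBall x₀ ρ, (Hess u y).trace ≤ 2 * n / ρ := by
  set w : Euc n → ℝ := fun y => u y - ρ⁻¹ * ‖y - x₀‖ ^ 2 with hw
  have hcont : ContinuousOn w (Metric.closedBall x₀ ρ) :=
    ContinuousOn.sub (fun y hy => (hu y hy).continuousAt.continuousWithinAt)
      (by fun_prop)
  have hx₀ : x₀ ∈ Metric.closedBall x₀ ρ := Metric.mem_closedBall_self hρ.le
  have hbdry : ∀ y ∈ Metric.sphere x₀ ρ, w y ≤ w x₀ := by
    intro y hy
    have hy' := Metric.sphere_subset_closedBall hy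
    have hlip := (convex_closedBall x₀ ρ).norm_image_sub_le_of_norm_fderiv_le (C := 1)
      (fun z hz => (hu z hz).differentiableAt (by norm_num))
      (fun z hz => by
        have := hgrad z hz
        rwa [← (InnerProductSpace.toDual ℝ (Euc n)).norm_map, toDual_gradient] at this) hx₀ hy'
    rw [mem_sphere_iff_norm] at hy
    rw [hy, one_mul, Real.norm_eq_abs] at hlip
    have h1 := (abs_le.1 hlip).2
    have h2 : ρ⁻¹ * ρ ^ 2 = ρ := by field_simp
    simp only [hw, hy, h2, sub_self, norm_zero]
    linarith
  obtain ⟨z, hz, hzmax⟩ := (isCompact_closedBall x₀ ρ).exists_isMaxOn ⟨x₀, hx₀⟩ hcont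
  obtain ⟨y, hy, hymax⟩ : ∃ y ∈ Metric.ball x₀ ρ, IsMaxOn w (Metric.closedBall x₀ ρ) y := by
    by_cases hzb : z ∈ Metric.sphere x₀ ρ
    · exact ⟨x₀, Metric.mem_ball_self hρ, fun q hq => (hzmax hq).trans (hbdry z hzb)⟩
    · refine ⟨z, lt_of_le_of_ne hz hzb, hzmax⟩
  have hnhds : Metric.closedBall x₀ ρ ∈ 𝓝 y :=
    Filter.mem_of_superset (Metric.isOpen_ball.mem_nhds hy) Metric.ball_subset_closedBall
  have hyc := Metric.ball_subset_closedBall hy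
  refine ⟨y, hyc, ?_⟩
  have hdiag : ∀ i, Hess u y i i ≤ 2 / ρ := by
    intro i
    set e : Euc n := EuclideanSpace.single i 1 with he
    have hline : ∀ t : ℝ, HasDerivAt (fun t : ℝ => y + t • e) e t := fun t => by
      simpa using ((hasDerivAt_id t).smul_const e).const_add y
    have htends : Filter.Tendsto (fun t : ℝ => y + t • e) (𝓝 0) (𝓝 y) := by
      simpa using (hline 0).continuousAt.tendsto
    have hmax : IsLocalMax (fun t : ℝ => w (y + t • e)) 0 := by
      filter_upwards [htends.eventually hnhds] with t ht
      simpa using hymax ht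
    have hφ : ∀ᶠ t : ℝ in 𝓝 0, HasDerivAt (fun t : ℝ => w (y + t • e))
        (gradient u (y + t • e) i - ρ⁻¹ * (2 * inner ℝ (y + t • e - x₀) e)) t := by
      filter_upwards [htends.eventually hnhds] with t ht
      have h1 := ((hu _ ht).differentiableAt (by norm_num)).hasFDerivAt.comp_hasDerivAt t (hline t)
      have h2 := (((hline t).sub_const x₀).norm_sq).const_mul ρ⁻¹
      rw [gradient_apply]
      exact h1.sub h2
    have hφ' : HasDerivAt
        (fun t : ℝ => gradient u (y + t • e) i - ρ⁻¹ * (2 * inner ℝ (y + t • e - x₀) e))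
        (Hess u y i i - ρ⁻¹ * (2 * 1)) 0 := by
      have hy0 : ContDiffAt ℝ 2 u (y + (0 : ℝ) • e) := by simpa using hu y hyc
      have h1 := (hasFDerivAt_gradient_apply hy0 i).comp_hasDerivAt 0 (hline 0)
      have h2 : HasDerivAt (fun t : ℝ => inner ℝ (y + t • e - x₀) e) 1 0 := by
        have := ((hline 0).sub_const x₀).inner ℝ (hasDerivAt_const 0 e)
        simpa [he] using this
      have h3 : HasDerivAt (fun t : ℝ => gradient u (y + t • e) i) (Hess u y i i) 0 := by
        simpa [he, gradientDeriv_single_apply, Function.comp_def] using h1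
      exact h3.sub ((h2.const_mul 2).const_mul ρ⁻¹)
    have := second_deriv_nonpos_of_isLocalMax hmax hφ hφ'
    rw [div_eq_mul_inv]
    linarith
  calc (Hess u y).trace ≤ ∑ _i : Fin n, 2 / ρ := Finset.sum_le_sum fun i _ => hdiag i
    _ = 2 * n / ρ := by simp; ring

/-- If the Hessian is positive semidefinite with trace at most `M` on `Ω`, the volume of the
gradient image is at most `(M/n)ⁿ |Ω|`. -/
theorem volume_gradient_image_le (hn : 0 < n) {Ω : Set (Euc n)} (hΩ : IsOpen Ω)
    (hΩfin : volume Ω ≠ ⊤) (hu : ∀ y ∈ Ω, ContDiffAt ℝ 2 u y)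
    (hpos : ∀ y ∈ Ω, (Hess u y).PosSemidef) {M : ℝ} (hM : 0 ≤ M)
    (htr : ∀ y ∈ Ω, (Hess u y).trace ≤ M) :
    (volume (gradient u '' Ω)).toReal ≤ (M / n) ^ n * (volume Ω).toReal := by
  have hle : volume (gradient u '' Ω) ≤ ENNReal.ofReal ((M / n) ^ n) * volume Ω := by
    calc volume (gradient u '' Ω)
        ≤ ∫⁻ y in Ω, ENNReal.ofReal |(gradientDeriv u y).det| :=
          addHaar_image_le_lintegral_abs_det_fderiv volume hΩ.measurableSet
            fun y hy => (hasFDerivAt_gradient (hu y hy)).hasFDerivWithinAt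
      _ ≤ ∫⁻ _ in Ω, ENNReal.ofReal ((M / n) ^ n) := by
          refine setLIntegral_mono' hΩ.measurableSet fun y hy => ENNReal.ofReal_le_ofReal ?_
          rw [det_gradientDeriv, abs_of_nonneg (hpos y hy).det_nonneg]
          refine (det_le_trace_div_pow hn (hpos y hy)).trans ?_
          have := (hpos y hy).trace_nonneg
          have := htr y hy
          gcongr
      _ = ENNReal.ofReal ((M / n) ^ n) * volume Ω := by simp
  have h := ENNReal.toReal_mono (ENNReal.mul_ne_top ENNReal.ofReal_ne_top hΩfin) hle
  rwa [ENNReal.toReal_mul, ENNReal.toReal_ofReal (by positivity)] at h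

theorem mul_add_mul_bounds {a b q A T : ℝ} (ha : 1 ≤ a) (haA : a ≤ A) (hb : 0 ≤ b) (hbA : b ≤ A)
    (hq : 0 ≤ q) (hqT : q ≤ T) : T ≤ a * (T + b * q) ∧ a * (T + b * q) ≤ A * (1 + A) * T := by
  have hT : 0 ≤ T := hq.trans hqT
  have hA : 0 ≤ A := hb.trans hbA
  have hbq : 0 ≤ b * q := mul_nonneg hb hq
  refine ⟨by nlinarith, ?_⟩
  calc a * (T + b * q) ≤ A * (T + A * T) := by gcongr
    _ = A * (1 + A) * T := by ring

theorem exists_pos_le_one_sub_norm_sq {K : Set (Euc n)} (hK : IsCompact K)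
    (hne : K.Nonempty) (hball : K ⊆ Metric.ball (0 : Euc n) 1) :
    ∃ w : ℝ, 0 < w ∧ ∀ p ∈ K, w ≤ 1 - ‖p‖ ^ 2 := by
  obtain ⟨p₀, hp₀, hmax⟩ := hK.exists_isMaxOn hne continuous_norm.continuousOn
  have hlt : ‖p₀‖ < 1 := by simpa using hball hp₀
  refine ⟨1 - ‖p₀‖ ^ 2, by nlinarith [norm_nonneg p₀], fun p hp => ?_⟩
  have : ‖p‖ ≤ ‖p₀‖ := hmax hp
  gcongr

/-- Comparison of the mean curvature operator with the Laplacian. -/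
theorem MinkDiv_bounds {w : ℝ} (hw : 0 < w) (hwp : w ≤ 1 - ‖gradient u x‖ ^ 2)
    (hu : ContDiffAt ℝ 2 u x) (hpos : (Hess u x).PosSemidef) :
    (Hess u x).trace ≤ MinkDiv u x ∧
      MinkDiv u x ≤ w⁻¹ * (1 + w⁻¹) * (Hess u x).trace := by
  obtain ⟨ha, haA, hb, hbA⟩ := Smat_coeff_bounds hw hwp
  have hlt : ‖gradient u x‖ < 1 := by nlinarith [norm_nonneg (gradient u x)]
  rw [MinkDiv_eq hu hlt]
  refine mul_add_mul_bounds ha haA hb hbA (quadForm_nonneg hpos _) ?_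
  refine (quadForm_le_trace hpos _).trans (mul_le_of_le_one_left hpos.trace_nonneg ?_)
  linarith

theorem trace_mul_Smat_mul_bounds {A : Matrix (Fin n) (Fin n) ℝ} (hA : A.PosSemidef) {p : Euc n}
    {w : ℝ} (hw : 0 < w) (hwp : w ≤ 1 - ‖p‖ ^ 2) :
    A.trace ^ 2 ≤ n * (A * Smat p * A).trace ∧
      (A * Smat p * A).trace ≤ w⁻¹ * (1 + w⁻¹) * A.trace ^ 2 := by
  obtain ⟨ha, haA, hb, hbA⟩ := Smat_coeff_bounds hw hwp
  have hsum : (0 : ℝ) ≤ ∑ i, ∑ j, A i j ^ 2 := by positivity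
  obtain ⟨h1, h2⟩ := mul_add_mul_bounds ha haA hb hbA
    (q := ∑ i, (∑ j, A i j * p j) ^ 2) (T := ∑ i, ∑ j, A i j ^ 2) (by positivity)
    ((sum_sq_mulVec_le A p).trans (mul_le_of_le_one_left hsum (by linarith)))
  rw [trace_mul_Smat_mul hA.isHermitian]
  refine ⟨(sq_trace_le_card_mul_sum_sq A).trans (by gcongr), h2.trans ?_⟩
  exact mul_le_mul_of_nonneg_left (sum_sq_le_sq_trace hA) (by positivity)

theorem trace_Smat_bounds (hn : 0 < n) {p : Euc n} {w : ℝ} (hw : 0 < w)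
    (hwp : w ≤ 1 - ‖p‖ ^ 2) :
    (n : ℝ) ≤ (Smat p).trace ∧ (Smat p).trace ≤ w⁻¹ * (1 + w⁻¹) * n := by
  obtain ⟨ha, haA, hb, hbA⟩ := Smat_coeff_bounds hw hwp
  have hn' : (1 : ℝ) ≤ n := by exact_mod_cast hn
  rw [trace_Smat]
  exact mul_add_mul_bounds ha haA hb hbA (sq_nonneg _) (by linarith)

theorem statement_6 {n : ℕ} (hn : 2 ≤ n)
    (Ω Ωt : Set (Euc n)) (ht h : Euc n → ℝ) (θt θ : ℝ)
    (hdom : DomainSetup Ω Ωt ht h θt θ)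
    (hball : closure Ωt ⊆ Metric.ball (0 : Euc n) 1)
    (f : Euc n × Euc n → ℝ)
    (hf : ContDiffOn ℝ 2 f (closure Ω ×ˢ closure Ωt))
    (hosc : OSCcond Ω Ωt f) :
    ∃ Λ₈ Λ₉ : ℝ, 0 < Λ₈ ∧ 0 < Λ₉ ∧
      ∀ (c : ℝ) (u : Euc n → ℝ), IsStrictSol Ω Ωt f c u → ∀ x ∈ Ω,
        (Λ₈ ≤ (Hess u x * Smat (gradient u x) * Hess u x).trace ∧
          (Hess u x * Smat (gradient u x) * Hess u x).trace ≤ Λ₉) ∧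
        (Λ₈ ≤ (Smat (gradient u x)).trace ∧ (Smat (gradient u x)).trace ≤ Λ₉) := by
  obtain ⟨hΩo, hΩto, hΩb, hΩtb, ⟨x₀, hx₀⟩, hΩtne, -⟩ := hdom
  have hn0 : 0 < n := by omega
  have hn' : (0 : ℝ) < n := by exact_mod_cast hn0
  obtain ⟨w, hw, hwp⟩ :=
    exists_pos_le_one_sub_norm_sq hΩtb.isCompact_closure hΩtne.closure hball
  obtain ⟨ρ, hρ, hρΩ⟩ := Metric.nhds_basis_closedBall.mem_iff.1 (hΩo.mem_nhds hx₀)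
  set C : ℝ := w⁻¹ * (1 + w⁻¹) with hC
  have hCpos : 0 < C := by positivity
  have hΩfin : volume Ω ≠ ⊤ := hΩb.measure_lt_top.ne
  have hΩpos : 0 < (volume Ω).toReal :=
    ENNReal.toReal_pos (hΩo.measure_pos volume ⟨x₀, hx₀⟩).ne' hΩfin
  have hΩtpos : 0 < (volume Ωt).toReal :=
    ENNReal.toReal_pos (hΩto.measure_pos volume hΩtne).ne' hΩtb.measure_lt_top.ne
  set r : ℝ := ((volume Ωt).toReal / (volume Ω).toReal) ^ ((1 : ℝ) / n) with hr
  have hrpos : 0 < r := by positivity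
  set O : ℝ := (n : ℝ) / 2 * r with hO
  have hOpos : 0 < O := by positivity
  refine ⟨min n ((O / C) ^ 2 / n), max (C * (C * (2 * n / ρ) + O) ^ 2) (C * n),
    lt_min hn' (by positivity), lt_max_of_lt_right (by positivity), ?_⟩
  rintro c u ⟨hu, hpd, -, heq, himg⟩ x hx
  have huat : ∀ y ∈ Ω, ContDiffAt ℝ 2 u y := fun y hy =>
    hu.contDiffAt (Filter.mem_of_superset (hΩo.mem_nhds hy) subset_closure)
  have hpsd : ∀ y ∈ Ω, (Hess u y).PosSemidef := fun y hy => (hpd y (subset_closure hy)).posSemidef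
  have hgrad : ∀ y ∈ Ω, gradient u y ∈ closure Ωt := fun y hy =>
    subset_closure (himg ▸ mem_image_of_mem _ hy)
  have hwg : ∀ y ∈ Ω, w ≤ 1 - ‖gradient u y‖ ^ 2 := fun y hy => hwp _ (hgrad y hy)
  have hF := fun y hy => MinkDiv_bounds hw (hwg y hy) (huat y hy) (hpsd y hy)
  have hoscF : ∀ y ∈ Ω, ∀ z ∈ Ω, MinkDiv u y ≤ MinkDiv u z + O := by
    intro y hy z hz
    have h := (abs_le.1 (hosc y (subset_closure hy) z (subset_closure hz) _ (hgrad y hy) _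
      (hgrad z hz))).2
    rw [heq y hy, heq z hz]
    linarith
  have hlow : O / C ≤ (Hess u x).trace := by
    have hM : 0 ≤ MinkDiv u x + O :=
      add_nonneg ((hpsd x hx).trace_nonneg.trans (hF x hx).1) hOpos.le
    have hvol := volume_gradient_image_le hn0 hΩo hΩfin huat hpsd hM fun y hy =>
      (hF y hy).1.trans (hoscF y hy x hx)
    rw [himg, ← div_le_iff₀ hΩpos] at hvol
    have hroot : r ≤ (MinkDiv u x + O) / n := by
      have h := Real.rpow_le_rpow (by positivity) hvol (by positivity : (0 : ℝ) ≤ (n : ℝ)⁻¹)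
      rw [Real.pow_rpow_inv_natCast (by positivity) hn0.ne'] at h
      rwa [hr, one_div]
    rw [le_div_iff₀ hn'] at hroot
    rw [div_le_iff₀ hCpos, mul_comm]
    have := (hF x hx).2
    linarith
  have hup : (Hess u x).trace ≤ C * (2 * n / ρ) + O := by
    obtain ⟨y, hy, hytr⟩ := exists_trace_Hess_le hρ (fun y hy => huat y (hρΩ hy))
      fun y hy => by nlinarith [hwg y (hρΩ hy), norm_nonneg (gradient u y)]
    calc (Hess u x).trace ≤ MinkDiv u y + O := (hF x hx).1.trans (hoscF x hx y (hρΩ hy))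
      _ ≤ C * (Hess u y).trace + O := by gcongr; exact (hF y (hρΩ hy)).2
      _ ≤ C * (2 * n / ρ) + O := by gcongr
  obtain ⟨h1, h2⟩ := trace_mul_Smat_mul_bounds (hpsd x hx) hw (hwg x hx)
  obtain ⟨h3, h4⟩ := trace_Smat_bounds hn0 hw (hwg x hx)
  refine ⟨⟨(min_le_right _ _).trans ?_, le_trans ?_ (le_max_left _ _)⟩,
    (min_le_left _ _).trans h3, h4.trans (le_max_right _ _)⟩
  · rw [div_le_iff₀ hn', mul_comm]
    exact le_trans (by gcongr) h1
  · have := (hpsd x hx).trace_nonneg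
    exact h2.trans (by gcongr)

end
end

section
/- For every K > 0 there exist constants ε > 0, τ̃ > 0 and C₈ > 0, depending only on n, Ω, Ω̃, h, h̃, θ, θ̃ and K, with the following property. Let f ∈ 𝒜 with ‖f‖_{C²(Ω̄ × closure(Ω̃))} ≤ K satisfy condition (OSC) and sup_{Ω̄ × closure(Ω̃)} |D_x f| ≤ ε; let u be a smooth uniformly convex solution of the second boundary value problem with data (f, c) and let ũ be its Legendre transform. Define ω̃ : closure(Ω̃) → ℝ by ω̃(y) := ⟨∇h̃(∇ũ(y)), ∇h(y)⟩ + τ̃·h̃(∇ũ(y)). Then at every point y₀ ∈ ∂Ω̃ at which ω̃ attains its minimum over ∂Ω̃, the directional derivative of ω̃ at y₀ in the inner normal direction ν̃(y₀) = ∇h(y₀) satisfies D_{ν̃(y₀)}ω̃(y₀) ≥ −C₈. -/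
open Set MeasureTheory Matrix
open scoped Topology RealInnerProductSpace NNReal

noncomputable section

variable {n : ℕ}

section

set_option maxSynthPendingDepth 3

/-- The second derivative of `u` at `x`, as a bilinear form. -/
abbrev D2 (u : Euc n → ℝ) (x : Euc n) : Euc n →L[ℝ] Euc n →L[ℝ] ℝ :=
  fderiv ℝ (fderiv ℝ u) x

lemma hess_apply (u : Euc n → ℝ) (x : Euc n) (i j : Fin n) :
    Hess u x i j = D2 u x (EuclideanSpace.single i 1) (EuclideanSpace.single j 1) := by
  simp [Hess, iteratedFDeriv_two_apply]

lemma euc_eq_sum (a : Euc n) : a = ∑ i, a i • EuclideanSpace.single i (1 : ℝ) := by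
  ext j
  simp [Finset.sum_apply, Pi.single_apply]

lemma dotProduct_hess_mulVec (u : Euc n → ℝ) (x a b : Euc n) :
    (fun i => a i) ⬝ᵥ (Hess u x).mulVec (fun i => b i) = D2 u x a b := by
  conv_rhs => rw [euc_eq_sum a, euc_eq_sum b]
  simp only [dotProduct, Matrix.mulVec, hess_apply, Finset.mul_sum, map_sum, map_smul,
    _root_.sum_apply, _root_.smul_apply, smul_eq_mul]
  rw [Finset.sum_comm]
  refine Finset.sum_congr rfl fun i _ => Finset.sum_congr rfl fun j _ => ?_
  ring

lemma differentiableAt_fderiv_of_hess_ne_zero {u : Euc n → ℝ} {x : Euc n} (h : Hess u x ≠ 0) :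
    DifferentiableAt ℝ (fderiv ℝ u) x := by
  by_contra hd
  refine h ?_
  ext i j
  rw [hess_apply, D2, fderiv_zero_of_not_differentiableAt hd]
  simp

lemma dotProduct_self_euc (a : Euc n) : (fun i => a i) ⬝ᵥ (fun i => a i) = ‖a‖ ^ 2 := by
  rw [EuclideanSpace.real_norm_sq_eq]
  simp [dotProduct, sq]

lemma D2_le_of_matLE {u : Euc n → ℝ} {x : Euc n} {θ : ℝ}
    (h : MatLE (Hess u x) ((-θ) • (1 : Matrix (Fin n) (Fin n) ℝ))) (a : Euc n) :
    D2 u x a a ≤ -θ * ‖a‖ ^ 2 := by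
  have h1 := h.dotProduct_mulVec_nonneg (fun i => a i)
  rw [Matrix.sub_mulVec, dotProduct_sub, Matrix.smul_mulVec, Matrix.one_mulVec, dotProduct_smul,
    star_trivial, dotProduct_hess_mulVec, dotProduct_self_euc, smul_eq_mul] at h1
  linarith

/-- The Riesz identification of the dual with the space, as a real linear map. -/
def rieszSymm : (Euc n →L[ℝ] ℝ) →L[ℝ] Euc n :=
  LinearMap.toContinuousLinearMap
    { toFun := (InnerProductSpace.toDual ℝ (Euc n)).symm
      map_add' := map_add _
      map_smul' := fun c a => by simp }

lemma rieszSymm_apply (a : Euc n →L[ℝ] ℝ) :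
    rieszSymm a = (InnerProductSpace.toDual ℝ (Euc n)).symm a := rfl

lemma gradient_eq_rieszSymm_comp (u : Euc n → ℝ) : gradient u = rieszSymm ∘ fderiv ℝ u := rfl

lemma differentiableAt_gradient {u : Euc n → ℝ} {x : Euc n}
    (h : DifferentiableAt ℝ (fderiv ℝ u) x) : DifferentiableAt ℝ (gradient u) x :=
  rieszSymm.differentiableAt.comp x h

lemma fderiv_gradient {u : Euc n → ℝ} {x : Euc n}
    (h : DifferentiableAt ℝ (fderiv ℝ u) x) (a : Euc n) :
    fderiv ℝ (gradient u) x a = (InnerProductSpace.toDual ℝ (Euc n)).symm (D2 u x a) := by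
  rw [gradient_eq_rieszSymm_comp, (rieszSymm.hasFDerivAt.comp x h.hasFDerivAt).fderiv]
  rfl

lemma inner_fderiv_gradient {u : Euc n → ℝ} {x : Euc n}
    (h : DifferentiableAt ℝ (fderiv ℝ u) x) (a b : Euc n) :
    ⟪fderiv ℝ (gradient u) x a, b⟫ = D2 u x a b := by
  rw [fderiv_gradient h, InnerProductSpace.toDual_symm_apply]

lemma norm_fderiv_gradient_apply {u : Euc n → ℝ} {x : Euc n}
    (h : DifferentiableAt ℝ (fderiv ℝ u) x) (a : Euc n) :
    ‖fderiv ℝ (gradient u) x a‖ = ‖D2 u x a‖ := by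
  rw [fderiv_gradient h, LinearIsometryEquiv.norm_map]

/-- Evaluation of a bilinear form at a pair of vectors. -/
def evalForm (a b : Euc n) : (Euc n →L[ℝ] Euc n →L[ℝ] ℝ) →L[ℝ] ℝ :=
  (ContinuousLinearMap.apply ℝ ℝ b).comp (ContinuousLinearMap.apply ℝ (Euc n →L[ℝ] ℝ) a)

@[simp] lemma evalForm_apply (a b : Euc n) (B : Euc n →L[ℝ] Euc n →L[ℝ] ℝ) :
    evalForm a b B = B a b := rfl

/-- Contraction of a bilinear form with the coefficient matrix `S(p)` of the Minkowski mean
curvature operator. -/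
def minkTrace (p : Euc n) : (Euc n →L[ℝ] Euc n →L[ℝ] ℝ) →L[ℝ] ℝ :=
  (Real.sqrt (1 - ‖p‖ ^ 2))⁻¹ •
    ((∑ i, evalForm (EuclideanSpace.single i 1) (EuclideanSpace.single i 1)) +
      (1 - ‖p‖ ^ 2)⁻¹ • evalForm p p)

lemma minkTrace_apply (p : Euc n) (B : Euc n →L[ℝ] Euc n →L[ℝ] ℝ) :
    minkTrace p B = (Real.sqrt (1 - ‖p‖ ^ 2))⁻¹ *
      ((∑ i, B (EuclideanSpace.single i 1) (EuclideanSpace.single i 1)) +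
        (1 - ‖p‖ ^ 2)⁻¹ * B p p) := by
  simp [minkTrace, mul_add]

lemma one_sub_norm_sq_pos {p : Euc n} (hp : ‖p‖ < 1) : 0 < 1 - ‖p‖ ^ 2 := by
  nlinarith [norm_nonneg p]

lemma minkTrace_nonneg {p : Euc n} (hp : ‖p‖ < 1) {B : Euc n →L[ℝ] Euc n →L[ℝ] ℝ}
    (hB : ∀ a, 0 ≤ B a a) : 0 ≤ minkTrace p B := by
  have := one_sub_norm_sq_pos hp
  rw [minkTrace_apply]
  exact mul_nonneg (by positivity) (add_nonneg (Finset.sum_nonneg fun i _ => hB _)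
    (mul_nonneg (by positivity) (hB _)))

lemma sum_le_minkTrace {p : Euc n} (hp : ‖p‖ < 1) {B : Euc n →L[ℝ] Euc n →L[ℝ] ℝ}
    (hB : ∀ a, 0 ≤ B a a) :
    ∑ i, B (EuclideanSpace.single i 1) (EuclideanSpace.single i 1) ≤ minkTrace p B := by
  have h0 := one_sub_norm_sq_pos hp
  have h1 : 1 ≤ (Real.sqrt (1 - ‖p‖ ^ 2))⁻¹ := by
    rw [one_le_inv₀ (by positivity), Real.sqrt_le_one]
    nlinarith [norm_nonneg p]
  have h2 : 0 ≤ ∑ i, B (EuclideanSpace.single i 1) (EuclideanSpace.single i 1) :=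
    Finset.sum_nonneg fun i _ => hB _
  have h3 : 0 ≤ (1 - ‖p‖ ^ 2)⁻¹ * B p p := mul_nonneg (by positivity) (hB _)
  rw [minkTrace_apply]
  nlinarith

lemma contDiffOn_minkTrace :
    ContDiffOn ℝ (⊤ : ℕ∞) (minkTrace (n := n)) (Metric.ball 0 1) := by
  rw [contDiffOn_clm_apply]
  intro B p hp
  have h0 := (one_sub_norm_sq_pos (mem_ball_zero_iff.mp hp)).ne'
  have h1 : ContDiffAt ℝ (⊤ : ℕ∞) (fun p : Euc n => 1 - ‖p‖ ^ 2) p :=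
    contDiffAt_const.sub (contDiff_norm_sq ℝ).contDiffAt
  have h2 : ContDiffAt ℝ (⊤ : ℕ∞) (fun p : Euc n => (Real.sqrt (1 - ‖p‖ ^ 2))⁻¹) p :=
    (h1.sqrt h0).inv (by
      have := one_sub_norm_sq_pos (mem_ball_zero_iff.mp hp)
      positivity)
  have h3 : ContDiffAt ℝ (⊤ : ℕ∞) (fun p : Euc n => B p p) p := by fun_prop
  simp only [minkTrace_apply]
  exact (h2.mul (contDiffAt_const.add ((h1.inv h0).mul h3))).contDiffWithinAt

lemma minkDiv_eq {u : Euc n → ℝ} {x : Euc n} (h : DifferentiableAt ℝ (fderiv ℝ u) x)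
    (hp : ‖gradient u x‖ < 1) : MinkDiv u x = minkTrace (gradient u x) (D2 u x) := by
  set p := gradient u x with hpdef
  set A := fderiv ℝ (gradient u) x with hA
  have h0 := one_sub_norm_sq_pos hp
  have hg : HasFDerivAt (gradient u) A x := (differentiableAt_gradient h).hasFDerivAt
  have hs : 0 < Real.sqrt (1 - ‖p‖ ^ 2) := Real.sqrt_pos.mpr h0
  have h1 := (hg.norm_sq.const_sub 1).sqrt h0.ne'
  have h2 : HasFDerivAt (fun y => (Real.sqrt (1 - ‖gradient u y‖ ^ 2))⁻¹) _ x :=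
    (hasDerivAt_inv hs.ne').comp_hasFDerivAt x h1
  have key : ∀ i, fderiv ℝ (fun y => (Real.sqrt (1 - ‖gradient u y‖ ^ 2))⁻¹ * gradient u y i) x
      (EuclideanSpace.single i 1) = (Real.sqrt (1 - ‖p‖ ^ 2))⁻¹ *
        (D2 u x (EuclideanSpace.single i 1) (EuclideanSpace.single i 1) +
          (1 - ‖p‖ ^ 2)⁻¹ * (p i * D2 u x (EuclideanSpace.single i 1) p)) := by
    intro i
    have h3 : HasFDerivAt (fun y => gradient u y i) ((EuclideanSpace.proj i).comp A) x :=
      (EuclideanSpace.proj i : Euc n →L[ℝ] ℝ).hasFDerivAt.comp x hg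
    rw [(h2.fun_mul h3).fderiv, ← inner_fderiv_gradient h _ p, ← inner_fderiv_gradient h, ← hA]
    simp [← hpdef, real_inner_comm p, EuclideanSpace.inner_single_right, -one_div]
    have hss : Real.sqrt (1 - ‖p‖ ^ 2) ^ 2 = 1 - ‖p‖ ^ 2 := Real.sq_sqrt h0.le
    rw [hss]
    field_simp
  rw [MinkDiv, minkTrace_apply, Finset.sum_congr rfl fun i _ => key i, ← Finset.mul_sum,
    Finset.sum_add_distrib, ← Finset.mul_sum]
  congr 3
  have hsum : D2 u x p = ∑ i, p i • D2 u x (EuclideanSpace.single i 1) := by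
    conv_lhs => rw [euc_eq_sum p]
    simp
  rw [hsum]
  simp

lemma det_fderiv_gradient {u : Euc n → ℝ} {x : Euc n}
    (h : DifferentiableAt ℝ (fderiv ℝ u) x) :
    (fderiv ℝ (gradient u) x).det = (Hess u x).det := by
  rw [ContinuousLinearMap.det, ← LinearMap.det_toMatrix (EuclideanSpace.basisFun (Fin n) ℝ).toBasis,
    ← Matrix.det_transpose]
  congr 1
  ext i j
  rw [hess_apply, ← inner_fderiv_gradient h, Matrix.transpose_apply, LinearMap.toMatrix_apply]
  simp [EuclideanSpace.inner_single_right]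

lemma Matrix.PosSemidef.det_le_pow_trace_div (hn : 0 < n) {M : Matrix (Fin n) (Fin n) ℝ}
    (hM : M.PosSemidef) : M.det ≤ (M.trace / n) ^ n := by
  have hn' : (n : ℝ) ≠ 0 := by positivity
  have h1 := hM.1.det_eq_prod_eigenvalues
  have h2 := hM.1.trace_eq_sum_eigenvalues
  simp only [RCLike.ofReal_real_eq_id, id] at h1 h2
  rw [h1, h2]
  have h3 := Real.geom_mean_le_arith_mean_weighted Finset.univ (fun _ : Fin n => (1 / n : ℝ))
    hM.1.eigenvalues (fun _ _ => by positivity) (by simp [hn']) (fun i _ => hM.eigenvalues_nonneg i)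
  rw [Real.finsetProd_rpow _ _ (fun i _ => hM.eigenvalues_nonneg i), ← Finset.mul_sum] at h3
  have h4 : 0 ≤ ∏ i, hM.1.eigenvalues i := Finset.prod_nonneg fun i _ => hM.eigenvalues_nonneg i
  calc ∏ i, hM.1.eigenvalues i
      = ((∏ i, hM.1.eigenvalues i) ^ (1 / n : ℝ)) ^ n := by
        rw [← Real.rpow_natCast, ← Real.rpow_mul h4, one_div_mul_cancel hn', Real.rpow_one]
    _ ≤ (1 / n * ∑ i, hM.1.eigenvalues i) ^ n := by gcongr
    _ = _ := by rw [one_div_mul_eq_div]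

lemma half_rpow_le_of_trace_le (hn : 0 < n) {Ω : Set (Euc n)} (hΩ : IsOpen Ω)
    (hbd : Bornology.IsBounded Ω) (hne : Ω.Nonempty) {u F : Euc n → ℝ}
    (hd : ∀ x ∈ Ω, DifferentiableAt ℝ (fderiv ℝ u) x) (hpos : ∀ x ∈ Ω, (Hess u x).PosSemidef)
    (hF : ∀ x ∈ Ω, (Hess u x).trace ≤ F x)
    {r : ℝ} (hr : r = ((volume (gradient u '' Ω)).toReal / (volume Ω).toReal) ^ ((1 : ℝ) / n))
    (hosc : ∀ x ∈ Ω, ∀ y ∈ Ω, |F x - F y| ≤ (n : ℝ) / 2 * r) {x : Euc n} (hx : x ∈ Ω) :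
    (n : ℝ) / 2 * r ≤ F x := by
  have hn' : (0 : ℝ) < n := by positivity
  have hvpos : 0 < (volume Ω).toReal :=
    ENNReal.toReal_pos (hΩ.measure_pos volume hne).ne' hbd.measure_lt_top.ne
  set m : ℝ := (F x + n / 2 * r) / n with hm
  have hFm : ∀ y ∈ Ω, F y / n ≤ m := fun y hy => by
    have := (abs_le.mp (hosc x hx y hy)).1
    rw [hm]
    gcongr
    linarith
  have hdet0 : ∀ y ∈ Ω, 0 ≤ (Hess u y).det := fun y hy => (hpos y hy).det_nonneg
  have htr0 : ∀ y ∈ Ω, 0 ≤ (Hess u y).trace := fun y hy => (hpos y hy).trace_nonneg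
  have hm0 : 0 ≤ m := le_trans (div_nonneg ((htr0 x hx).trans (hF x hx)) hn'.le) (hFm x hx)
  have hdet : ∀ y ∈ Ω, |(fderiv ℝ (gradient u) y).det| ≤ m ^ n := fun y hy => by
    rw [det_fderiv_gradient (hd y hy), abs_of_nonneg (hdet0 y hy)]
    refine ((hpos y hy).det_le_pow_trace_div hn).trans ?_
    refine pow_le_pow_left₀ (div_nonneg (htr0 y hy) hn'.le) (le_trans ?_ (hFm y hy)) n
    gcongr
    exact hF y hy
  have hvol : volume (gradient u '' Ω) ≤ ENNReal.ofReal (m ^ n) * volume Ω := by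
    refine (addHaar_image_le_lintegral_abs_det_fderiv volume hΩ.measurableSet fun y hy =>
      (differentiableAt_gradient (hd y hy)).hasFDerivAt.hasFDerivWithinAt).trans ?_
    rw [← setLIntegral_const]
    exact setLIntegral_mono' hΩ.measurableSet fun y hy => ENNReal.ofReal_le_ofReal (hdet y hy)
  have hvol' : (volume (gradient u '' Ω)).toReal / (volume Ω).toReal ≤ m ^ n := by
    rw [div_le_iff₀ hvpos]
    have := ENNReal.toReal_mono
      (ENNReal.mul_ne_top ENNReal.ofReal_ne_top hbd.measure_lt_top.ne) hvol
    rwa [ENNReal.toReal_mul, ENNReal.toReal_ofReal (by positivity)] at this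
  have hrm : r ≤ m := by
    rw [hr]
    calc _ ≤ (m ^ n) ^ ((1 : ℝ) / n) := by gcongr
      _ = m := by
        rw [← Real.rpow_natCast, ← Real.rpow_mul hm0, mul_one_div_cancel hn'.ne', Real.rpow_one]
  rw [hm, le_div_iff₀ hn'] at hrm
  linarith

lemma two_le_infty : (2 : WithTop ℕ∞) ≤ ((⊤ : ℕ∞) : WithTop ℕ∞) :=
  WithTop.coe_le_coe.mpr le_top

lemma D2_symm {u : Euc n → ℝ} {x : Euc n} (hu : ContDiffAt ℝ (⊤ : ℕ∞) u x) (a b : Euc n) :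
    D2 u x a b = D2 u x b a :=
  hu.isSymmSndFDerivAt (by simpa using two_le_infty) a b

lemma contDiffAt_fderiv {F G : Type*} [NormedAddCommGroup F] [NormedSpace ℝ F]
    [NormedAddCommGroup G] [NormedSpace ℝ G] {g : F → G} {x : F}
    (hg : ContDiffAt ℝ (⊤ : ℕ∞) g x) : ContDiffAt ℝ (⊤ : ℕ∞) (fderiv ℝ g) x :=
  hg.fderiv_right (by simp)

lemma eventually_contDiffAt {F G : Type*} [NormedAddCommGroup F] [NormedSpace ℝ F]
    [NormedAddCommGroup G] [NormedSpace ℝ G] {g : F → G} {x : F}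
    (hg : ContDiffAt ℝ 2 g x) : ∀ᶠ y in 𝓝 x, DifferentiableAt ℝ g y :=
  (hg.eventually (by simp)).mono fun _ hy => hy.differentiableAt (by simp)

lemma fderiv_D2_symm_left {u : Euc n → ℝ} {x : Euc n} (hu : ContDiffAt ℝ (⊤ : ℕ∞) u x)
    (a b c : Euc n) : fderiv ℝ (D2 u) x a b c = fderiv ℝ (D2 u) x b a c := by
  have := (contDiffAt_fderiv hu).isSymmSndFDerivAt (by simpa using two_le_infty) a b
  exact DFunLike.congr_fun this c

lemma fderiv_D2_symm_right {u : Euc n → ℝ} {Ω : Set (Euc n)} (hΩ : IsOpen Ω)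
    (hu : ∀ x ∈ Ω, ContDiffAt ℝ (⊤ : ℕ∞) u x) {x : Euc n} (hx : x ∈ Ω)
    (a b c : Euc n) : fderiv ℝ (D2 u) x a b c = fderiv ℝ (D2 u) x a c b := by
  have hd : DifferentiableAt ℝ (D2 u) x :=
    (contDiffAt_fderiv (contDiffAt_fderiv (hu x hx))).differentiableAt (by simp)
  have key : ∀ b c, fderiv ℝ (fun y => D2 u y b c) x a = fderiv ℝ (D2 u) x a b c := fun b c => by
    have h1 : HasFDerivAt (fun y => D2 u y b c) ((evalForm b c).comp (fderiv ℝ (D2 u) x)) x :=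
      (evalForm b c).hasFDerivAt.comp x hd.hasFDerivAt
    rw [h1.fderiv]
    rfl
  rw [← key, ← key]
  congr 1
  refine Filter.EventuallyEq.fderiv_eq ?_
  filter_upwards [hΩ.mem_nhds hx] with y hy using D2_symm (hu y hy) b c

lemma fderiv_fderiv_comp {E F : Type*} [NormedAddCommGroup E] [NormedSpace ℝ E]
    [NormedAddCommGroup F] [NormedSpace ℝ F] {P : F → ℝ} {g : E → F} {x : E}
    (hP : ContDiffAt ℝ 2 P (g x)) (hg : ContDiffAt ℝ 2 g x) (a b : E) :
    fderiv ℝ (fderiv ℝ (P ∘ g)) x a b =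
      fderiv ℝ (fderiv ℝ P) (g x) (fderiv ℝ g x a) (fderiv ℝ g x b) +
        fderiv ℝ P (g x) (fderiv ℝ (fderiv ℝ g) x a b) := by
  have h1 : fderiv ℝ (P ∘ g) =ᶠ[𝓝 x] fun y => (fderiv ℝ P (g y)).comp (fderiv ℝ g y) := by
    filter_upwards [eventually_contDiffAt hg,
      hg.continuousAt.eventually (eventually_contDiffAt hP)] with y hy1 hy2
    exact fderiv_comp y hy2 hy1
  have h2 : HasFDerivAt (fun y => fderiv ℝ P (g y))
      ((fderiv ℝ (fderiv ℝ P) (g x)).comp (fderiv ℝ g x)) x :=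
    ((hP.fderiv_right (m := 1) (by norm_num)).differentiableAt (by simp)).hasFDerivAt.comp x
      (hg.differentiableAt (by simp)).hasFDerivAt
  have h3 : HasFDerivAt (fderiv ℝ g) (fderiv ℝ (fderiv ℝ g) x) x :=
    ((hg.fderiv_right (m := 1) (by norm_num)).differentiableAt (by simp)).hasFDerivAt
  rw [h1.fderiv_eq, (h2.clm_comp h3).fderiv]
  simp [add_comm]

lemma IsLocalMin.fderiv_fderiv_nonneg {E : Type*} [NormedAddCommGroup E] [NormedSpace ℝ E]
    {f : E → ℝ} {x : E} (hmin : IsLocalMin f x) (hf : ContDiffAt ℝ 2 f x) (a : E) :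
    0 ≤ fderiv ℝ (fderiv ℝ f) x a a := by
  set l : ℝ → E := fun t => x + t • a with hl
  have hl0 : l 0 = x := by simp [hl]
  have hlc : Continuous l := by fun_prop
  have hld : ∀ t, HasDerivAt l a t := fun t => by
    have := ((hasDerivAt_id t).smul_const a).const_add x
    rwa [one_smul] at this
  have htend : Filter.Tendsto l (𝓝 0) (𝓝 x) := by
    simpa [hl0] using hlc.tendsto 0
  have hd1 : deriv (f ∘ l) =ᶠ[𝓝 0] fun t => fderiv ℝ f (l t) a := by
    filter_upwards [htend.eventually (eventually_contDiffAt hf)] with t ht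
    exact (ht.hasFDerivAt.comp_hasDerivAt t (hld t)).deriv
  have hd2 : deriv (deriv (f ∘ l)) 0 = fderiv ℝ (fderiv ℝ f) x a a := by
    rw [hd1.deriv_eq]
    have h1 : HasFDerivAt (fderiv ℝ f) (fderiv ℝ (fderiv ℝ f) x) (l 0) := by
      rw [hl0]
      exact ((hf.fderiv_right (m := 1) (by norm_num)).differentiableAt (by simp)).hasFDerivAt
    have h2 := (h1.comp_hasDerivAt 0 (hld 0)).clm_apply (hasDerivAt_const (0 : ℝ) a)
    simpa using h2.deriv
  have hlmin : IsLocalMin (f ∘ l) 0 := by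
    have := htend.eventually hmin
    simpa [IsLocalMin, IsMinFilter, hl0] using this
  by_contra! hneg
  have hmax := isLocalMax_of_deriv_deriv_neg (f := f ∘ l) (x₀ := 0) (by rwa [hd2])
    hlmin.deriv_eq_zero
    (ContinuousAt.comp (by rw [hl0]; exact hf.continuousAt) hlc.continuousAt)
  have hconst : f ∘ l =ᶠ[𝓝 0] fun _ => (f ∘ l) 0 := by
    filter_upwards [hlmin, hmax] with t h1 h2 using le_antisymm h2 h1
  have h0 : deriv (deriv (f ∘ l)) 0 = 0 := by
    rw [hconst.deriv.deriv_eq]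
    simp
  rw [← hd2, h0] at hneg
  exact lt_irrefl _ hneg

/-- The real inner product as a bounded bilinear form. -/
def innerForm : Euc n →L[ℝ] Euc n →L[ℝ] ℝ :=
  LinearMap.mkContinuous₂ (innerₗ (Euc n)) 1 fun a b => by
    simpa using abs_real_inner_le_norm a b

@[simp] lemma innerForm_apply (a b : Euc n) : innerForm a b = ⟪a, b⟫ := rfl

lemma norm_innerForm_le : ‖innerForm (n := n)‖ ≤ 1 :=
  LinearMap.mkContinuous₂_norm_le _ zero_le_one _

lemma norm_sq_clm_le_sum (A : Euc n →L[ℝ] Euc n) (a : Euc n) :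
    ‖A a‖ ^ 2 ≤ (∑ i, ‖A (EuclideanSpace.single i 1)‖ ^ 2) * ‖a‖ ^ 2 := by
  have h1 : ‖A a‖ ≤ ∑ i, |a i| * ‖A (EuclideanSpace.single i 1)‖ := by
    conv_lhs => rw [euc_eq_sum a, map_sum]
    refine (norm_sum_le _ _).trans_eq (Finset.sum_congr rfl fun i _ => ?_)
    rw [map_smul, norm_smul, Real.norm_eq_abs]
  calc ‖A a‖ ^ 2 ≤ (∑ i, |a i| * ‖A (EuclideanSpace.single i 1)‖) ^ 2 := by gcongr
    _ ≤ (∑ i, |a i| ^ 2) * ∑ i, ‖A (EuclideanSpace.single i 1)‖ ^ 2 :=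
      Finset.sum_mul_sq_le_sq_mul_sq _ _ _
    _ = _ := by
      rw [EuclideanSpace.real_norm_sq_eq, mul_comm]
      simp

/-- The contraction of `D²u · D²u` with the coefficient matrix `S(∇u)`. -/
def gramTrace (u : Euc n → ℝ) (x : Euc n) : ℝ :=
  minkTrace (gradient u x)
    (innerForm.bilinearComp (fderiv ℝ (gradient u) x) (fderiv ℝ (gradient u) x))

lemma norm_D2_sq_le_gramTrace {u : Euc n → ℝ} {x : Euc n}
    (h : DifferentiableAt ℝ (fderiv ℝ u) x) (hp : ‖gradient u x‖ < 1) :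
    ‖D2 u x‖ ^ 2 ≤ gramTrace u x := by
  have h1 := sum_le_minkTrace hp
    (B := innerForm.bilinearComp (fderiv ℝ (gradient u) x) (fderiv ℝ (gradient u) x))
    (fun a => by simp)
  simp only [ContinuousLinearMap.bilinearComp_apply, innerForm_apply,
    real_inner_self_eq_norm_sq] at h1
  refine le_trans ?_ h1
  set t := ∑ i, ‖fderiv ℝ (gradient u) x (EuclideanSpace.single i 1)‖ ^ 2
  have ht : 0 ≤ t := Finset.sum_nonneg fun i _ => by positivity
  have h2 : ‖D2 u x‖ ≤ Real.sqrt t := by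
    refine ContinuousLinearMap.opNorm_le_bound _ (Real.sqrt_nonneg _) fun a => ?_
    rw [← norm_fderiv_gradient_apply h]
    refine le_of_sq_le_sq ?_ (by positivity)
    rw [mul_pow, Real.sq_sqrt ht]
    exact norm_sq_clm_le_sum _ _
  calc ‖D2 u x‖ ^ 2 ≤ Real.sqrt t ^ 2 := by gcongr
    _ = t := Real.sq_sqrt ht

lemma contDiffAt_gradient {u : Euc n → ℝ} {x : Euc n} (hu : ContDiffAt ℝ (⊤ : ℕ∞) u x) :
    ContDiffAt ℝ (⊤ : ℕ∞) (gradient u) x :=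
  rieszSymm.contDiff.contDiffAt.comp x (contDiffAt_fderiv hu)

lemma inner_fderiv_fderiv_gradient {u : Euc n → ℝ} {x : Euc n}
    (hu : ContDiffAt ℝ (⊤ : ℕ∞) u x) (a b ξ : Euc n) :
    ⟪ξ, fderiv ℝ (fderiv ℝ (gradient u)) x a b⟫ = fderiv ℝ (D2 u) x a b ξ := by
  have h := fderiv_fderiv_comp (P := fun v : Euc n => innerForm ξ v) (g := gradient u) (x := x)
    (innerForm ξ).contDiff.contDiffAt ((contDiffAt_gradient hu).of_le two_le_infty) a b
  have h1 : fderiv ℝ (fun v : Euc n => innerForm ξ v) = fun _ => innerForm ξ := by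
    ext1 v
    exact (innerForm ξ).fderiv
  have h2 : (fun v : Euc n => innerForm ξ v) ∘ gradient u =
      fun y => ContinuousLinearMap.apply ℝ ℝ ξ (fderiv ℝ u y) := by
    ext y
    change ⟪ξ, gradient u y⟫ = fderiv ℝ u y ξ
    rw [real_inner_comm, inner_gradient_left]
  have h3 := fderiv_fderiv_comp (P := fun v : Euc n →L[ℝ] ℝ => ContinuousLinearMap.apply ℝ ℝ ξ v)
    (g := fderiv ℝ u) (x := x) (ContinuousLinearMap.contDiff _).contDiffAt
    ((contDiffAt_fderiv hu).of_le two_le_infty) a b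
  have h4 : fderiv ℝ (fun v : Euc n →L[ℝ] ℝ => ContinuousLinearMap.apply ℝ ℝ ξ v) =
      fun _ => ContinuousLinearMap.apply ℝ ℝ ξ := by
    ext1 v
    exact (ContinuousLinearMap.apply ℝ ℝ ξ).fderiv
  rw [h1] at h
  rw [h4] at h3
  rw [h2] at h
  have h5 := h.symm.trans h3
  simpa using h5

lemma minkTrace_fderiv_D2 {Ω : Set (Euc n)} (hΩ : IsOpen Ω) {u : Euc n → ℝ} {c : ℝ}
    {f : Euc n × Euc n → ℝ} (hpde : ∀ x ∈ Ω, minkTrace (gradient u x) (D2 u x) =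
      f (x, gradient u x) + c) {x : Euc n} (hx : x ∈ Ω)
    (hu : ContDiffAt ℝ (⊤ : ℕ∞) u x) (hp : ‖gradient u x‖ < 1)
    (hf : DifferentiableAt ℝ f (x, gradient u x)) (ξ : Euc n) :
    minkTrace (gradient u x) (fderiv ℝ (D2 u) x ξ) =
      fderiv ℝ f (x, gradient u x) (ξ, fderiv ℝ (gradient u) x ξ) -
        fderiv ℝ minkTrace (gradient u x) (fderiv ℝ (gradient u) x ξ) (D2 u x) := by
  have hg : HasFDerivAt (gradient u) (fderiv ℝ (gradient u) x) x :=
    ((contDiffAt_gradient hu).differentiableAt (by simp)).hasFDerivAt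
  have hD : HasFDerivAt (D2 u) (fderiv ℝ (D2 u) x) x :=
    ((contDiffAt_fderiv (contDiffAt_fderiv hu)).differentiableAt (by simp)).hasFDerivAt
  have hq : HasFDerivAt minkTrace (fderiv ℝ minkTrace (gradient u x)) (gradient u x) :=
    ((contDiffOn_minkTrace.contDiffAt (Metric.isOpen_ball.mem_nhds
      (mem_ball_zero_iff.mpr hp))).differentiableAt (by simp)).hasFDerivAt
  have h1 : HasFDerivAt (fun y => minkTrace (gradient u y) (D2 u y)) _ x :=
    (hq.comp x hg).clm_apply hD
  have h2 : HasFDerivAt (fun y => f (y, gradient u y) + c) _ x :=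
    (hf.hasFDerivAt.comp x ((hasFDerivAt_id x).prodMk hg)).add_const c
  have h3 : (fun y => minkTrace (gradient u y) (D2 u y)) =ᶠ[𝓝 x]
      fun y => f (y, gradient u y) + c := by
    filter_upwards [hΩ.mem_nhds hx] with y hy using hpde y hy
  have h4 := DFunLike.congr_fun (h1.unique (h2.congr_of_eventuallyEq h3)) ξ
  simp at h4
  linarith

lemma hasFDerivAt_prodMk_gradient {u : Euc n → ℝ} {x : Euc n}
    (hu : ContDiffAt ℝ (⊤ : ℕ∞) u x) :
    HasFDerivAt (fun y => (y, gradient u y))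
      ((ContinuousLinearMap.id ℝ (Euc n)).prod (fderiv ℝ (gradient u) x)) x :=
  (hasFDerivAt_id x).prodMk ((contDiffAt_gradient hu).differentiableAt (by simp)).hasFDerivAt

lemma fderiv_fderiv_prodMk_gradient {u : Euc n → ℝ} {Ω : Set (Euc n)} (hΩ : IsOpen Ω)
    (hu : ∀ x ∈ Ω, ContDiffAt ℝ (⊤ : ℕ∞) u x) {x : Euc n} (hx : x ∈ Ω) (a b : Euc n) :
    fderiv ℝ (fderiv ℝ fun y => (y, gradient u y)) x a b =
      (0, fderiv ℝ (fderiv ℝ (gradient u)) x a b) := by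
  have h1 : (fderiv ℝ fun y => (y, gradient u y)) =ᶠ[𝓝 x]
      fun y => (ContinuousLinearMap.inl ℝ (Euc n) (Euc n)) +
        (ContinuousLinearMap.inr ℝ (Euc n) (Euc n)).comp (fderiv ℝ (gradient u) y) := by
    filter_upwards [hΩ.mem_nhds hx] with y hy
    rw [(hasFDerivAt_prodMk_gradient (hu y hy)).fderiv]
    ext v <;> simp
  have h2 : HasFDerivAt (fderiv ℝ (gradient u)) (fderiv ℝ (fderiv ℝ (gradient u)) x) x :=
    ((contDiffAt_fderiv (contDiffAt_gradient (hu x hx))).differentiableAt (by simp)).hasFDerivAt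
  rw [h1.fderiv_eq, (((hasFDerivAt_const _ x).clm_comp h2).const_add _).fderiv]
  simp

set_option maxHeartbeats 1000000 in
/-- The second-order necessary condition at an interior local minimum of
`H(x, ∇u) + C h(∇u)`, contracted with the coefficients of the linearized operator. -/
lemma gramTrace_le_of_isLocalMin {Ω : Set (Euc n)} (hΩ : IsOpen Ω) {u : Euc n → ℝ} {c : ℝ}
    {f : Euc n × Euc n → ℝ} (hu : ∀ x ∈ Ω, ContDiffAt ℝ (⊤ : ℕ∞) u x)
    (hpde : ∀ x ∈ Ω, minkTrace (gradient u x) (D2 u x) = f (x, gradient u x) + c)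
    {x : Euc n} (hx : x ∈ Ω) (hp : ‖gradient u x‖ < 1)
    (hf : DifferentiableAt ℝ f (x, gradient u x))
    {K ε M C θ : ℝ} (hC : 0 ≤ C) (hε0 : 0 ≤ ε) (hM : 0 ≤ M)
    (hK : ‖fderiv ℝ f (x, gradient u x)‖ ≤ K)
    (hε : ∀ ξ : Euc n, |fderiv ℝ f (x, gradient u x) (ξ, 0)| ≤ ε * ‖ξ‖)
    {H : Euc n × Euc n → ℝ} (hH : ContDiff ℝ (⊤ : ℕ∞) H)
    {h : Euc n → ℝ} (hh : ContDiff ℝ (⊤ : ℕ∞) h)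
    (hH1 : ‖fderiv ℝ H (x, gradient u x)‖ ≤ M)
    (hH2 : ‖fderiv ℝ (fderiv ℝ H) (x, gradient u x)‖ ≤ M)
    (hh1 : ‖fderiv ℝ h (gradient u x)‖ ≤ M)
    (hh2 : ∀ a, D2 h (gradient u x) a a ≤ -θ * ‖a‖ ^ 2)
    (hq : ‖minkTrace (gradient u x)‖ ≤ M)
    (hq' : ‖fderiv ℝ minkTrace (gradient u x)‖ ≤ M)
    (hmin : IsLocalMin (fun y => H (y, gradient u y) + C * h (gradient u y)) x) :
    C * θ * gramTrace u x ≤ M * M + M * gramTrace u x + ε * (M + C * M) + K * M +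
      M * M * ‖D2 u x‖ := by
  have hux := hu x hx
  have hgx := contDiffAt_gradient hux
  have hpair : ContDiffAt ℝ (⊤ : ℕ∞) (fun y => (y, gradient u y)) x := contDiffAt_id.prodMk hgx
  set p := gradient u x with hpdef
  set A := fderiv ℝ (gradient u) x with hA
  have hd : DifferentiableAt ℝ (fderiv ℝ u) x := (contDiffAt_fderiv hux).differentiableAt (by simp)
  -- The composite, as a sum of two compositions.
  set P : Euc n × Euc n → ℝ := fun z => H z + C * h z.2 with hP
  have hPs : ContDiff ℝ (⊤ : ℕ∞) P := hH.add (contDiff_const.mul (hh.comp contDiff_snd))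
  have hcomp : (fun y => H (y, gradient u y) + C * h (gradient u y)) =
      P ∘ fun y => (y, gradient u y) := rfl
  rw [hcomp] at hmin
  have hhd : Differentiable ℝ h := hh.differentiable (by simp)
  have hP1 : fderiv ℝ P = fun z => fderiv ℝ H z +
      C • (fderiv ℝ h z.2).comp (ContinuousLinearMap.snd ℝ (Euc n) (Euc n)) := by
    ext1 z
    exact ((hH.differentiable (by simp) z).hasFDerivAt.add
      (((hhd z.2).hasFDerivAt.comp z hasFDerivAt_snd).const_mul C)).fderiv
  have hP2 : ∀ v : Euc n × Euc n, fderiv ℝ (fderiv ℝ P) (x, p) v v =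
      fderiv ℝ (fderiv ℝ H) (x, p) v v + C * D2 h p v.2 v.2 := fun v => by
    have h1 : HasFDerivAt (fderiv ℝ H) (fderiv ℝ (fderiv ℝ H) (x, p)) (x, p) :=
      ((contDiffAt_fderiv hH.contDiffAt).differentiableAt (by simp)).hasFDerivAt
    have h2 : HasFDerivAt (fderiv ℝ h) (D2 h p) p :=
      ((contDiffAt_fderiv hh.contDiffAt).differentiableAt (by simp)).hasFDerivAt
    have h3 : HasFDerivAt (fun z : Euc n × Euc n => fderiv ℝ h z.2)
        ((D2 h p).comp (ContinuousLinearMap.snd ℝ (Euc n) (Euc n))) (x, p) :=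
      HasFDerivAt.comp (x, p) h2 hasFDerivAt_snd
    have h4 := h1.add ((h3.clm_comp
      (hasFDerivAt_const (ContinuousLinearMap.snd ℝ (Euc n) (Euc n)) (x, p))).const_smul C)
    rw [hP1]
    refine (DFunLike.congr_fun (DFunLike.congr_fun h4.fderiv v) v).trans ?_
    simp
  set ξ : Euc n := rieszSymm
    ((fderiv ℝ H (x, p)).comp (ContinuousLinearMap.inr ℝ (Euc n) (Euc n)) + C • fderiv ℝ h p) with hξ
  have hξi : ∀ b, ⟪ξ, b⟫ = fderiv ℝ P (x, p) (0, b) := fun b => by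
    rw [hξ, rieszSymm_apply, InnerProductSpace.toDual_symm_apply, hP1]
    simp
  have hξn : ‖ξ‖ ≤ M + C * M := by
    rw [hξ, rieszSymm_apply, LinearIsometryEquiv.norm_map]
    refine (norm_add_le _ _).trans (add_le_add ?_ ?_)
    · refine (ContinuousLinearMap.opNorm_comp_le _ _).trans ?_
      calc _ ≤ M * 1 := by
            gcongr
            exact ContinuousLinearMap.norm_inr_le_one _ _ _
        _ = M := mul_one M
    · rw [norm_smul, Real.norm_eq_abs, abs_of_nonneg hC]
      gcongr
  have hinl : ∀ b, fderiv ℝ P (x, p) (b, 0) = fderiv ℝ H (x, p) (b, 0) := fun b => by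
    rw [hP1]
    simp
  -- First-order condition.
  have hfirst : ∀ b, D2 u x ξ b = -fderiv ℝ H (x, p) (b, 0) := fun b => by
    have h0 := hmin.fderiv_eq_zero
    have h1 : HasFDerivAt (P ∘ fun y => (y, gradient u y)) _ x :=
      HasFDerivAt.comp x (hPs.differentiable (by simp) (x, p)).hasFDerivAt
        (hasFDerivAt_prodMk_gradient hux)
    rw [h1.fderiv] at h0
    have h2 : fderiv ℝ P (x, p) (b, A b) = 0 := DFunLike.congr_fun h0 b
    have h3 : ((b, A b) : Euc n × Euc n) = (b, 0) + (0, A b) := by simp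
    rw [h3, map_add, ← hξi, hinl, real_inner_comm, hA, inner_fderiv_gradient hd,
      D2_symm hux] at h2
    linarith
  have hAξ : ‖A ξ‖ ≤ M := by
    rw [hA, norm_fderiv_gradient_apply hd]
    refine ContinuousLinearMap.opNorm_le_bound _ hM fun b => ?_
    rw [hfirst, norm_neg]
    refine (ContinuousLinearMap.le_opNorm _ _).trans ?_
    have : ‖((b, 0) : Euc n × Euc n)‖ = ‖b‖ := by simp [Prod.norm_def]
    rw [this]
    gcongr
  -- Second-order condition.
  have hsecond : ∀ a, fderiv ℝ (fderiv ℝ (P ∘ fun y => (y, gradient u y))) x a a =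
      fderiv ℝ (fderiv ℝ H) (x, p) (a, A a) (a, A a) + C * D2 h p (A a) (A a) +
        fderiv ℝ (D2 u) x ξ a a := fun a => by
    rw [fderiv_fderiv_comp (hPs.contDiffAt.of_le two_le_infty) (hpair.of_le two_le_infty),
      fderiv_fderiv_prodMk_gradient hΩ hu hx, (hasFDerivAt_prodMk_gradient hux).fderiv, ← hξi,
      inner_fderiv_fderiv_gradient hux, fderiv_D2_symm_right hΩ hu hx, fderiv_D2_symm_left hux]
    congr 1
    exact hP2 (a, A a)
  have hnonneg : 0 ≤ minkTrace p (fderiv ℝ (fderiv ℝ (P ∘ fun y => (y, gradient u y))) x) :=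
    minkTrace_nonneg hp fun a => hmin.fderiv_fderiv_nonneg
      ((hPs.contDiffAt.comp x hpair).of_le two_le_infty) a
  have hle : 0 ≤ minkTrace p (M • innerForm + (M - C * θ) • innerForm.bilinearComp A A +
      fderiv ℝ (D2 u) x ξ - fderiv ℝ (fderiv ℝ (P ∘ fun y => (y, gradient u y))) x) := by
    refine minkTrace_nonneg hp fun a => ?_
    simp only [_root_.sub_apply, _root_.add_apply, _root_.smul_apply, innerForm_apply,
      ContinuousLinearMap.bilinearComp_apply, hsecond, real_inner_self_eq_norm_sq, smul_eq_mul]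
    have h1 : fderiv ℝ (fderiv ℝ H) (x, p) (a, A a) (a, A a) ≤ M * (‖a‖ ^ 2 + ‖A a‖ ^ 2) := by
      have h2 := (le_abs_self _).trans
        ((fderiv ℝ (fderiv ℝ H) (x, p)).le_opNorm₂ (a, A a) (a, A a))
      have h3 : ‖((a, A a) : Euc n × Euc n)‖ * ‖((a, A a) : Euc n × Euc n)‖ ≤
          ‖a‖ ^ 2 + ‖A a‖ ^ 2 := by
        rw [Prod.norm_def]
        rcases max_choice ‖a‖ ‖A a‖ with h4 | h4 <;> simp only [h4] <;> nlinarith [norm_nonneg a]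
      refine h2.trans ?_
      rw [mul_assoc]
      gcongr
    have h2 := mul_le_mul_of_nonneg_left (hh2 (A a)) hC
    nlinarith
  rw [map_sub, map_add, map_add, map_smul, map_smul, smul_eq_mul, smul_eq_mul,
    minkTrace_fderiv_D2 hΩ hpde hx hux hp hf] at hle
  have hI : minkTrace p innerForm ≤ M := by
    refine (Real.le_norm_self _).trans ((ContinuousLinearMap.le_opNorm _ _).trans ?_)
    calc _ ≤ M * 1 := by
          gcongr
          exact norm_innerForm_le
      _ = M := mul_one M
  have hfd : fderiv ℝ f (x, p) (ξ, A ξ) ≤ ε * (M + C * M) + K * M := by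
    have h3 : ((ξ, A ξ) : Euc n × Euc n) = (ξ, 0) + (0, A ξ) := by simp
    rw [h3, map_add]
    refine add_le_add (((le_abs_self _).trans (hε ξ)).trans (by gcongr)) ?_
    refine (Real.le_norm_self _).trans ((ContinuousLinearMap.le_opNorm _ _).trans ?_)
    have : ‖((0, A ξ) : Euc n × Euc n)‖ = ‖A ξ‖ := by simp [Prod.norm_def]
    rw [this]
    have := (norm_nonneg _).trans hK
    gcongr
  have hqd : -(fderiv ℝ minkTrace p (A ξ) (D2 u x)) ≤ M * M * ‖D2 u x‖ := by
    refine (neg_le_abs _).trans ?_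
    rw [← Real.norm_eq_abs]
    refine (ContinuousLinearMap.le_opNorm _ _).trans ?_
    gcongr
    exact (ContinuousLinearMap.le_opNorm _ _).trans (by gcongr)
  have hMI := mul_le_mul_of_nonneg_left hI hM
  have hG : minkTrace p (innerForm.bilinearComp A A) = gramTrace u x := rfl
  rw [hG] at hle
  linarith

lemma exists_uniform_bound {Ω Ωt : Set (Euc n)} (hΩ : Bornology.IsBounded Ω)
    (hΩt : Bornology.IsBounded Ωt) (hball : closure Ωt ⊆ Metric.ball (0 : Euc n) 1)
    {H : Euc n × Euc n → ℝ} (hH : ContDiff ℝ (⊤ : ℕ∞) H)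
    {h : Euc n → ℝ} (hh : ContDiff ℝ (⊤ : ℕ∞) h) :
    ∃ M : ℝ, 0 < M ∧ ∀ x ∈ closure Ω, ∀ p ∈ closure Ωt,
      ‖fderiv ℝ H (x, p)‖ ≤ M ∧ ‖fderiv ℝ (fderiv ℝ H) (x, p)‖ ≤ M ∧ ‖fderiv ℝ h p‖ ≤ M ∧
        ‖minkTrace p‖ ≤ M ∧ ‖fderiv ℝ minkTrace p‖ ≤ M := by
  have hc : IsCompact (closure Ωt) := hΩt.isCompact_closure
  have hcc : IsCompact (closure Ω ×ˢ closure Ωt) := hΩ.isCompact_closure.prod hc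
  have hH' : Continuous (fderiv ℝ H) := hH.continuous_fderiv (by simp)
  have hH'' : Continuous (fderiv ℝ (fderiv ℝ H)) :=
    (contDiff_iff_contDiffAt.2 fun z => contDiffAt_fderiv hH.contDiffAt).continuous_fderiv (by simp)
  have hmt : ∀ p ∈ closure Ωt, ContDiffAt ℝ (⊤ : ℕ∞) (minkTrace (n := n)) p := fun p hp =>
    contDiffOn_minkTrace.contDiffAt (Metric.isOpen_ball.mem_nhds (hball hp))
  obtain ⟨M₁, h₁⟩ := hcc.exists_bound_of_continuousOn hH'.continuousOn
  obtain ⟨M₂, h₂⟩ := hcc.exists_bound_of_continuousOn hH''.continuousOn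
  obtain ⟨M₃, h₃⟩ :=
    hc.exists_bound_of_continuousOn (hh.continuous_fderiv (by simp)).continuousOn
  obtain ⟨M₄, h₄⟩ := hc.exists_bound_of_continuousOn (f := minkTrace) fun p hp =>
    (hmt p hp).continuousAt.continuousWithinAt
  obtain ⟨M₅, h₅⟩ := hc.exists_bound_of_continuousOn (f := fderiv ℝ minkTrace) fun p hp =>
    (contDiffAt_fderiv (hmt p hp)).continuousAt.continuousWithinAt
  refine ⟨max 1 (max M₁ (max M₂ (max M₃ (max M₄ M₅)))), by positivity, fun x hx p hp =>
    ⟨(h₁ (x, p) ⟨hx, hp⟩).trans ?_, (h₂ (x, p) ⟨hx, hp⟩).trans ?_, (h₃ p hp).trans ?_,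
      (h₄ p hp).trans ?_, (h₅ p hp).trans ?_⟩⟩ <;> simp

lemma posSemidef_of_matLE_smul_one {A : Matrix (Fin n) (Fin n) ℝ} {δ : ℝ} (hδ : 0 ≤ δ)
    (h : MatLE (δ • (1 : Matrix (Fin n) (Fin n) ℝ)) A) : A.PosSemidef := by
  have h1 := Matrix.PosSemidef.add h (Matrix.PosSemidef.one.smul hδ)
  rwa [sub_add_cancel] at h1

lemma det_ne_zero_of_matLE_smul_one {A : Matrix (Fin n) (Fin n) ℝ} {δ : ℝ} (hδ : 0 < δ)
    (h : MatLE (δ • (1 : Matrix (Fin n) (Fin n) ℝ)) A) : A.det ≠ 0 := by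
  have h1 := Matrix.PosDef.posSemidef_add h (Matrix.PosDef.one.smul hδ)
  rw [sub_add_cancel] at h1
  exact h1.det_pos.ne'

/-- A one-sided minimum principle: if `ω + C h` is minimal at a boundary point of `{h > 0}`, then
the inner normal derivative of `ω` is at least `-C`. -/
lemma neg_le_fderiv_of_le_add_mul {h ω : Euc n → ℝ} {C : ℝ} (hC : 0 ≤ C) {y₀ : Euc n}
    (hh : DifferentiableAt ℝ h y₀) (h0 : h y₀ = 0) (hν : ‖gradient h y₀‖ = 1)
    (hle : ∀ y, 0 < h y → ω y₀ ≤ ω y + C * h y) : -C ≤ fderiv ℝ ω y₀ (gradient h y₀) := by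
  by_cases hω : DifferentiableAt ℝ ω y₀
  swap
  · rw [fderiv_zero_of_not_differentiableAt hω]
    simpa using hC
  set ν := gradient h y₀ with hνdef
  set l : ℝ → Euc n := fun t => y₀ + t • ν with hl
  have hl0 : l 0 = y₀ := by simp [hl]
  have hl' : HasDerivAt l ν 0 := by
    have h2 := ((hasDerivAt_id (0 : ℝ)).smul_const ν).const_add y₀
    rw [one_smul] at h2
    exact h2
  have h1 : fderiv ℝ h y₀ ν = 1 := by
    rw [← inner_gradient_left, ← hνdef, real_inner_self_eq_norm_sq, hν, one_pow]
  have hdh : HasDerivAt (fun t => h (l t)) 1 0 := by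
    rw [← h1]
    exact HasFDerivAt.comp_hasDerivAt (0 : ℝ) (by rw [hl0]; exact hh.hasFDerivAt) hl'
  have hdω : HasDerivAt (fun t => ω (l t)) (fderiv ℝ ω y₀ ν) 0 :=
    HasFDerivAt.comp_hasDerivAt (0 : ℝ) (by rw [hl0]; exact hω.hasFDerivAt) hl'
  have hd := hdω.add (hdh.const_mul C)
  have hslope := hd.hasDerivWithinAt (s := Ioi 0)
  rw [hasDerivWithinAt_iff_tendsto_slope' (by simp)] at hslope
  have hhs := hdh.hasDerivWithinAt (s := Ioi 0)
  rw [hasDerivWithinAt_iff_tendsto_slope' (by simp)] at hhs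
  have hpos : ∀ᶠ t in 𝓝[>] (0 : ℝ), 0 < h (l t) := by
    filter_upwards [hhs.eventually (lt_mem_nhds one_pos), self_mem_nhdsWithin] with t ht1 ht2
    rw [slope_def_field, hl0, h0, sub_zero, sub_zero] at ht1
    exact (div_pos_iff_of_pos_right ht2).1 ht1
  have hge := ge_of_tendsto hslope (b := 0) (by
    filter_upwards [hpos, self_mem_nhdsWithin] with t ht1 ht2
    rw [slope_def_field]
    refine div_nonneg ?_ (sub_nonneg.2 (le_of_lt ht2))
    have := hle _ ht1
    simp only [Pi.add_apply, hl0, h0]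
    linarith)
  linarith

/-- The choice of the smallness parameter and of the barrier constant rules out interior minima. -/
lemma barrier_contradiction {C θ t s M K ε c₁ : ℝ} (hθ : 0 < θ) (hM : 0 < M) (hK : 0 < K)
    (hc₁ : 0 < c₁) (ht : c₁ ≤ t) (hst : s ^ 2 ≤ t) (hε1 : ε ≤ 1) (hεM : ε * M ≤ θ * c₁ / 2)
    (hC : C = 2 * (2 * (M * M) + 2 * M + K * M) * (1 / c₁ + 1) / θ + 1)
    (hle : C * θ * t ≤ M * M + M * t + ε * (M + C * M) + K * M + M * M * s) : False := by
  set B := 2 * (M * M) + 2 * M + K * M with hB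
  have hBpos : 0 < B := by positivity
  have hCpos : 0 < C := by rw [hC]; positivity
  have htpos : 0 < t := hc₁.trans_le ht
  have hs : s ≤ 1 + t := by nlinarith [sq_nonneg (s - 1)]
  have h1 : C * (ε * M) ≤ C * (θ * t / 2) := by
    refine mul_le_mul_of_nonneg_left (hεM.trans ?_) hCpos.le
    nlinarith
  have h2 : ε * M ≤ M := by nlinarith
  have h3 : M * M * s ≤ M * M * (1 + t) := mul_le_mul_of_nonneg_left hs (by positivity)
  have h4 : C * θ * t / 2 ≤ B * (1 + t) := by
    have h5 : B * (1 + t) = 2 * (M * M) + 2 * M + K * M + (2 * (M * M) + 2 * M + K * M) * t := by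
      rw [hB]
      ring
    have h6 : 0 ≤ (M * M) * t := by positivity
    have h7 : 0 ≤ M * t := by positivity
    have h8 : 0 ≤ (K * M) * t := by positivity
    nlinarith
  have h5 : 1 ≤ t / c₁ := (one_le_div hc₁).2 ht
  have h6 : C * θ = 2 * B * (1 / c₁ + 1) + θ := by
    rw [hC]
    field_simp
  have h7 : B * (1 + t) ≤ B * (1 / c₁ + 1) * t := by
    have : B * (1 / c₁ + 1) * t = B * (t / c₁ + t) := by ring
    rw [this]
    gcongr
  have h8 : 0 < θ * t := by positivity
  rw [h6] at h4
  nlinarith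

lemma fderiv_prodMk_zero_apply {f : Euc n × Euc n → ℝ} {x p : Euc n}
    (hf : DifferentiableAt ℝ f (x, p)) (ξ : Euc n) :
    fderiv ℝ f (x, p) (ξ, 0) = fderiv ℝ (fun x' => f (x', p)) x ξ := by
  have h1 : HasFDerivAt (fun x' => f (x', p)) _ x :=
    HasFDerivAt.comp x hf.hasFDerivAt (hasFDerivAt_prodMk_left x p)
  rw [h1.fderiv]
  rfl

/-- A quantitative lower bound for `gramTrace` coming from the oscillation condition. -/
lemma sq_div_le_gramTrace (hn : 0 < n) {Ω Ωt : Set (Euc n)} (hΩ : IsOpen Ω)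
    (hbd : Bornology.IsBounded Ω) (hne : Ω.Nonempty)
    {f : Euc n × Euc n → ℝ} {c : ℝ} {u : Euc n → ℝ} (hosc : OSCcond Ω Ωt f)
    (hd : ∀ x ∈ Ω, DifferentiableAt ℝ (fderiv ℝ u) x) (hpos : ∀ x ∈ Ω, (Hess u x).PosSemidef)
    (hp : ∀ x ∈ Ω, ‖gradient u x‖ < 1)
    (hpde : ∀ x ∈ Ω, minkTrace (gradient u x) (D2 u x) = f (x, gradient u x) + c)
    (himg : gradient u '' Ω = Ωt) {x : Euc n} (hx : x ∈ Ω) {M : ℝ} (hM : 0 < M)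
    (hq : ‖minkTrace (gradient u x)‖ ≤ M) :
    ((n : ℝ) / 2 * ((volume Ωt).toReal / (volume Ω).toReal) ^ ((1 : ℝ) / n) / M) ^ 2 ≤
      gramTrace u x := by
  have hmem : ∀ y ∈ Ω, gradient u y ∈ closure Ωt := fun y hy =>
    subset_closure (himg ▸ mem_image_of_mem _ hy)
  have h1 := half_rpow_le_of_trace_le (F := fun y => f (y, gradient u y) + c) hn hΩ hbd hne hd hpos
    (fun y hy => by
      rw [← hpde y hy]
      refine le_trans (le_of_eq ?_) (sum_le_minkTrace (hp y hy) fun a => ?_)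
      · exact Finset.sum_congr rfl fun i _ => hess_apply u y i i
      · rw [← dotProduct_hess_mulVec]
        exact (hpos y hy).dotProduct_mulVec_nonneg _) rfl
    (fun y hy z hz => by
      rw [himg, add_sub_add_right_eq_sub]
      exact hosc y (subset_closure hy) z (subset_closure hz) _ (hmem y hy) _ (hmem z hz)) hx
  rw [himg, ← hpde x hx] at h1
  refine le_trans ?_ (norm_D2_sq_le_gramTrace (hd x hx) (hp x hx))
  refine pow_le_pow_left₀ (by positivity) ((div_le_iff₀ hM).2 (h1.trans ?_)) 2
  refine (Real.le_norm_self _).trans ((ContinuousLinearMap.le_opNorm _ _).trans ?_)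
  rw [mul_comm]
  gcongr

/-- For the barrier constant `C`, the function `H(x, ∇u) + C h(∇u)` has no interior minimum. -/
lemma not_isLocalMin_of_barrier (hn : 0 < n) {Ω Ωt : Set (Euc n)} (hΩ : IsOpen Ω)
    (hΩt : IsOpen Ωt) (hbd : Bornology.IsBounded Ω) (hne : Ω.Nonempty)
    {f : Euc n × Euc n → ℝ} {c K ε : ℝ} {u : Euc n → ℝ} (hf : C2Bound Ω Ωt f K)
    (hosc : OSCcond Ω Ωt f) (hDx : DxBound Ω Ωt f ε) (hsol : IsSmoothSol Ω Ωt f c u)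
    {H : Euc n × Euc n → ℝ} (hH : ContDiff ℝ (⊤ : ℕ∞) H)
    {h : Euc n → ℝ} (hh : ContDiff ℝ (⊤ : ℕ∞) h) {θ M C c₁ : ℝ} (hθ : 0 < θ) (hM : 0 < M)
    (hK : 0 < K) (hh2 : ∀ p a, D2 h p a a ≤ -θ * ‖a‖ ^ 2)
    (hbound : ∀ x ∈ closure Ω, ∀ p ∈ closure Ωt,
      ‖fderiv ℝ H (x, p)‖ ≤ M ∧ ‖fderiv ℝ (fderiv ℝ H) (x, p)‖ ≤ M ∧ ‖fderiv ℝ h p‖ ≤ M ∧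
        ‖minkTrace p‖ ≤ M ∧ ‖fderiv ℝ minkTrace p‖ ≤ M)
    (hc₁ : 0 < c₁) (hc₁' : c₁ =
      ((n : ℝ) / 2 * ((volume Ωt).toReal / (volume Ω).toReal) ^ ((1 : ℝ) / n) / M) ^ 2)
    (hε0 : 0 ≤ ε) (hε1 : ε ≤ 1) (hεM : ε * M ≤ θ * c₁ / 2)
    (hC : C = 2 * (2 * (M * M) + 2 * M + K * M) * (1 / c₁ + 1) / θ + 1)
    {x : Euc n} (hx : x ∈ Ω) :
    ¬ IsLocalMin (fun y => H (y, gradient u y) + C * h (gradient u y)) x := by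
  intro hmin
  obtain ⟨hu, ⟨δ, hδ, hHess⟩, hp, hpde, himg⟩ := hsol
  have huΩ : ∀ y ∈ Ω, ContDiffAt ℝ (⊤ : ℕ∞) u y := fun y hy =>
    hu.contDiffAt (Filter.mem_of_superset (hΩ.mem_nhds hy) subset_closure)
  have hd : ∀ y ∈ Ω, DifferentiableAt ℝ (fderiv ℝ u) y := fun y hy =>
    (contDiffAt_fderiv (huΩ y hy)).differentiableAt (by simp)
  have hpΩ : ∀ y ∈ Ω, ‖gradient u y‖ < 1 := fun y hy => hp y (subset_closure hy)
  have hpde' : ∀ y ∈ Ω, minkTrace (gradient u y) (D2 u y) = f (y, gradient u y) + c :=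
    fun y hy => by rw [← minkDiv_eq (hd y hy) (hpΩ y hy), hpde y hy]
  have hpx : gradient u x ∈ Ωt := himg ▸ mem_image_of_mem _ hx
  have hxc := subset_closure hx
  have hpc := subset_closure hpx
  obtain ⟨hH1, hH2, hh1, hq, hq'⟩ := hbound x hxc _ hpc
  have hfd : DifferentiableAt ℝ f (x, gradient u x) :=
    (hf.1.contDiffAt (Filter.mem_of_superset ((hΩ.prod hΩt).mem_nhds ⟨hx, hpx⟩)
      (prod_mono subset_closure subset_closure))).differentiableAt (by simp)
  have hCpos : 0 ≤ C := by rw [hC]; positivity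
  have hle := gramTrace_le_of_isLocalMin hΩ huΩ hpde' hx (hpΩ x hx) hfd hCpos hε0 hM.le
    (hf.2 _ ⟨hxc, hpc⟩).2.1
    (fun ξ => by
      rw [fderiv_prodMk_zero_apply hfd, ← Real.norm_eq_abs]
      exact ContinuousLinearMap.le_of_opNorm_le _ (hDx x hxc _ hpc) ξ)
    hH hh hH1 hH2 hh1 (hh2 _) hq hq' hmin
  have ht := sq_div_le_gramTrace hn hΩ hbd hne hosc hd
    (fun y hy => posSemidef_of_matLE_smul_one hδ.le (hHess y (subset_closure hy))) hpΩ hpde' himg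
    hx hM hq
  rw [← hc₁'] at ht
  exact barrier_contradiction hθ hM hK hc₁ ht (norm_D2_sq_le_gramTrace (hd x hx) (hpΩ x hx)) hε1
    hεM hC hle

end

theorem statement_10 {n : ℕ} (hn : 2 ≤ n)
    (Ω Ωt : Set (Euc n)) (ht h : Euc n → ℝ) (θt θ : ℝ)
    (hdom : DomainSetup Ω Ωt ht h θt θ)
    (hball : closure Ωt ⊆ Metric.ball (0 : Euc n) 1)
    :
    ∀ K : ℝ, 0 < K →
      ∃ ε τt C₈ : ℝ, 0 < ε ∧ 0 < τt ∧ 0 < C₈ ∧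
        ∀ f : Euc n × Euc n → ℝ, InA Ω Ωt f → C2Bound Ω Ωt f K → OSCcond Ω Ωt f →
          DxBound Ω Ωt f ε →
        ∀ (c : ℝ) (u ut : Euc n → ℝ), IsSmoothSol Ω Ωt f c u → IsLegendre Ω Ωt u ut →
        ∀ y₀ ∈ frontier Ωt,
          (∀ y ∈ frontier Ωt,
              ⟪gradient ht (gradient ut y₀), gradient h y₀⟫ + τt * ht (gradient ut y₀) ≤
                ⟪gradient ht (gradient ut y), gradient h y⟫ + τt * ht (gradient ut y)) →
          -C₈ ≤ fderiv ℝ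
              (fun y => ⟪gradient ht (gradient ut y), gradient h y⟫ + τt * ht (gradient ut y))
              y₀ (gradient h y₀) := by
  intro K hK
  obtain ⟨hΩ, hΩt, hbd, hbdt, hne, hnet, hht, hh, -, hΩteq, -, hν, -, hθ, -, hhess⟩ := hdom
  have hn0 : 0 < n := by lia
  set H : Euc n × Euc n → ℝ := fun z => ⟪gradient ht z.1, gradient h z.2⟫ + 1 * ht z.1 with hHdef
  have hgr : ∀ {g : Euc n → ℝ}, ContDiff ℝ (⊤ : ℕ∞) g → ContDiff ℝ (⊤ : ℕ∞) (gradient g) :=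
    fun hg => contDiff_iff_contDiffAt.2 fun _ => contDiffAt_gradient hg.contDiffAt
  have hH : ContDiff ℝ (⊤ : ℕ∞) H :=
    (((hgr hht).comp contDiff_fst).inner ℝ ((hgr hh).comp contDiff_snd)).add
      (contDiff_const.mul (hht.comp contDiff_fst))
  obtain ⟨M, hM, hbound⟩ := exists_uniform_bound hbd hbdt hball hH hh
  obtain ⟨c₁, hc₁'⟩ : ∃ c₁ : ℝ, c₁ =
    ((n : ℝ) / 2 * ((volume Ωt).toReal / (volume Ω).toReal) ^ ((1 : ℝ) / n) / M) ^ 2 := ⟨_, rfl⟩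
  have hc₁ : 0 < c₁ := by
    have h1 := ENNReal.toReal_pos (hΩ.measure_pos volume hne).ne' hbd.measure_lt_top.ne
    have h2 := ENNReal.toReal_pos (hΩt.measure_pos volume hnet).ne' hbdt.measure_lt_top.ne
    rw [hc₁']
    positivity
  obtain ⟨C, hC⟩ : ∃ C : ℝ,
    C = 2 * (2 * (M * M) + 2 * M + K * M) * (1 / c₁ + 1) / θ + 1 := ⟨_, rfl⟩
  have hCpos : 0 < C := by rw [hC]; positivity
  have hε : 0 < min 1 (θ * c₁ / 2 / M) := by positivity
  refine ⟨min 1 (θ * c₁ / 2 / M), 1, C, hε, one_pos, hCpos, ?_⟩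
  intro f _ hf hosc hDx c u ut hsol hleg y₀ hy₀ hmin
  have hzero : ∀ y ∈ frontier Ωt, h y = 0 := fun y hy => by
    rw [hΩteq] at hy
    exact (frontier_lt_subset_eq continuous_const hh.continuous hy).symm
  refine neg_le_fderiv_of_le_add_mul hCpos.le (hh.differentiable (by simp) y₀) (hzero y₀ hy₀)
    (hν y₀ hy₀) fun y hy => ?_
  have hnot : ∀ x ∈ Ω, ¬ IsLocalMin (fun y => H (y, gradient u y) + C * h (gradient u y)) x :=
    fun x hx => not_isLocalMin_of_barrier hn0 hΩ hΩt hbd hne hf hosc hDx hsol hH hh hθ hM hK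
      (fun p => D2_le_of_matLE (hhess p)) hbound hc₁ hc₁' hε.le (min_le_left _ _)
      ((le_div_iff₀ hM).1 (min_le_right _ _)) hC hx
  obtain ⟨-, ⟨δ, hδ, hHess⟩, -, -, himg⟩ := hsol
  obtain ⟨-, -, hinv, -⟩ := hleg
  have hgc : ContinuousOn (gradient u) (closure Ω) := fun x hx => by
    refine (differentiableAt_gradient (differentiableAt_fderiv_of_hess_ne_zero fun h0 => ?_)
      ).continuousAt.continuousWithinAt
    have : Nonempty (Fin n) := ⟨⟨0, hn0⟩⟩
    exact det_ne_zero_of_matLE_smul_one hδ (hHess x hx) (by rw [h0, Matrix.det_zero])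
  obtain ⟨xb, hxb, hxbmin⟩ := hbd.isCompact_closure.exists_isMinOn hne.closure
    (f := fun y => H (y, gradient u y) + C * h (gradient u y))
    ((hH.continuous.comp_continuousOn (continuousOn_id.prodMk hgc)).add
      (continuousOn_const.mul (hh.continuous.comp_continuousOn hgc)))
  have hxbΩ : xb ∉ Ω := fun hx => hnot xb hx
    (hxbmin.isLocalMin (Filter.mem_of_superset (hΩ.mem_nhds hx) subset_closure))
  have hyb : gradient u xb ∈ frontier Ωt := by
    rw [hΩt.frontier_eq]
    refine ⟨?_, fun hmem => hxbΩ ?_⟩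
    · rw [← himg]
      exact hgc.image_closure (mem_image_of_mem _ hxb)
    · rw [← himg] at hmem
      obtain ⟨x', hx', hxx⟩ := hmem
      rwa [← hinv xb hxb, ← hxx, hinv x' (subset_closure hx')]
  have hy' : y ∈ gradient u '' Ω := by
    rw [himg, hΩteq]
    exact hy
  obtain ⟨x, hx, rfl⟩ := hy'
  have h1 := hmin _ hyb
  have h2 := hxbmin (subset_closure hx)
  simp only [mem_ofPred_eq, hHdef, hzero _ hyb] at h2
  rw [hinv xb hxb] at h1
  simp only [hinv x (subset_closure hx)]
  linarith

end
end
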